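/- arXiv:2210.04550 — 4 statements merged into one kernel-verified Lean document; each statement's English description precedes it below -/
import Mathlib

section
/- Let n be a positive integer with n ≡ 5 (mod 6), H a finite abelian group of order n²+n+1, and T₀, T₁ inverse-closed subsets of H with e ∈ T₀ and |T₀| + |T₁| = 2n+1 satisfying the APLL group-ring equations. Let u = |T₀ ∩ {t³ : t ∈ T₁}| + |T₁ ∩ {t³ : t ∈ T₁}|, and for i ≥ 5 let s_i = (i−1)(i−4)/2 if i ≡ 1 (mod 3) and s_i = (i−2)(i−3)/2 otherwise. Then, as inequalities of rational numbers: 3|Y₀| ≤ n − 2u + 2 − θ₁; Σ_{i≥5} s_i·|Y_i| ≤ n − 2u + 2 − θ₁; 2n² − 6n + 7u − 4 + 2θ₁ ≤ 3|Y₁| ≤ 2n² − 2n − u + 4 − 2θ₁; and n² − 4n + 7u − 7 + 2θ₁ ≤ 3|Y₄| ≤ n² − n + u − 1 − θ₁. -/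
open scoped Classical Pointwise

/-- The APLL group-ring equations, stated via coefficient counts: for every `h ∈ H`,
`#{(a,b) ∈ T₀×T₁ : ab = h} = 1 − [h = e]`, and
`#{(a,b) ∈ T₀×T₀ : ab = h} + #{(a,b) ∈ T₁×T₁ : ab = h} + #{t ∈ T₀ : t² = h}
  + #{t ∈ T₁ : t² = h} = 2 + 2n·[h = e]`. -/
def APLLEqs {H : Type*} [CommGroup H] (n : ℕ) (T₀ T₁ : Set H) : Prop :=
  (∀ h : H,
      {p : H × H | p.1 ∈ T₀ ∧ p.2 ∈ T₁ ∧ p.1 * p.2 = h}.ncard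
        = if h = 1 then 0 else 1) ∧
  (∀ h : H,
      {p : H × H | p.1 ∈ T₀ ∧ p.2 ∈ T₀ ∧ p.1 * p.2 = h}.ncard
        + {p : H × H | p.1 ∈ T₁ ∧ p.2 ∈ T₁ ∧ p.1 * p.2 = h}.ncard
        + {t : H | t ∈ T₀ ∧ t ^ 2 = h}.ncard
        + {t : H | t ∈ T₁ ∧ t ^ 2 = h}.ncard
        = 2 + if h = 1 then 2 * n else 0)

/-- `Xset T₀ T₁ i` is the set of `h ∈ H` appearing with coefficient `i` in `T̂⁽²⁾T₀`. -/
def Xset {H : Type*} [CommGroup H] (T₀ T₁ : Set H) (i : ℕ) : Set H :=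
  {h : H | {p : H × H | p.1 ∈ T₀ ∪ T₁ ∧ p.2 ∈ T₀ ∧ p.1 ^ 2 * p.2 = h}.ncard = i}

/-- `Yset T₀ T₁ i` is the set of `h ∈ H` appearing with coefficient `i` in `T̂⁽²⁾T₁`. -/
def Yset {H : Type*} [CommGroup H] (T₀ T₁ : Set H) (i : ℕ) : Set H :=
  {h : H | {p : H × H | p.1 ∈ T₀ ∪ T₁ ∧ p.2 ∈ T₁ ∧ p.1 ^ 2 * p.2 = h}.ncard = i}

/-- `Vset T₀ T₁ i` is the set of `h ∈ H` appearing with coefficient `i` in `T̂⁽⁴⁾T₁`. -/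
def Vset {H : Type*} [CommGroup H] (T₀ T₁ : Set H) (i : ℕ) : Set H :=
  {h : H | {p : H × H | p.1 ∈ T₀ ∪ T₁ ∧ p.2 ∈ T₁ ∧ p.1 ^ 4 * p.2 = h}.ncard = i}

/-- `θ₀ = |(T₀T₀ ∖ T₀⁽²⁾) ∩ T̂⁽⁴⁾|`. -/
noncomputable def theta0 {H : Type*} [CommGroup H] (T₀ T₁ : Set H) : ℕ :=
  (((T₀ * T₀) \ ((fun t => t ^ 2) '' T₀)) ∩ ((fun g => g ^ 4) '' (T₀ ∪ T₁))).ncard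

/-- `θ₁ = |T₁ ∩ T̂⁽²⁾|/2 + |(T₁T₁ ∖ (T₁⁽²⁾ ∪ {e})) ∩ T̂⁽⁴⁾|`, as a rational number. -/
noncomputable def theta1 {H : Type*} [CommGroup H] (T₀ T₁ : Set H) : ℚ :=
  ((T₁ ∩ ((fun g => g ^ 2) '' (T₀ ∪ T₁))).ncard : ℚ) / 2
    + ((((T₁ * T₁) \ (((fun t => t ^ 2) '' T₁) ∪ {1}))
        ∩ ((fun g => g ^ 4) '' (T₀ ∪ T₁))).ncard : ℚ)

/-- `s_i = (i−1)(i−4)/2` if `i ≡ 1 (mod 3)`, and `(i−2)(i−3)/2` otherwise. -/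
def sCoef (i : ℕ) : ℚ :=
  if i % 3 = 1 then ((i : ℚ) - 1) * ((i : ℚ) - 4) / 2
  else ((i : ℚ) - 2) * ((i : ℚ) - 3) / 2

section GroupRing

open Finset

variable {H ι κ : Type*} (k : Type*) [CommRing k]

/-- The group-ring element `∑ i ∈ s, f i`. -/
noncomputable def groupRingSum (s : Finset ι) (f : ι → H) : MonoidAlgebra k H :=
  ∑ i ∈ s, MonoidAlgebra.single (f i) 1

variable {k}

lemma coeff_groupRingSum (s : Finset ι) (f : ι → H) (h : H) :
    (groupRingSum k s f).coeff h = (#{i ∈ s | f i = h} : k) := by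
  simp [groupRingSum, MonoidAlgebra.coeff_sum, Finsupp.single_apply, Finset.sum_boole]

lemma card_filter_eq_of_injective {f : ι → H} (hf : Function.Injective f) (s : Finset ι) (h : H) :
    #{i ∈ s | f i = h} = if h ∈ s.image f then 1 else 0 := by
  split_ifs with hh
  · obtain ⟨t, ht, rfl⟩ := Finset.mem_image.1 hh
    exact Finset.card_eq_one.2 ⟨t, by ext; simp only [hf.eq_iff]; grind⟩
  · exact Finset.card_eq_zero.2 (Finset.filter_eq_empty_iff.2 fun t ht e =>
      hh (Finset.mem_image.2 ⟨t, ht, e⟩))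

lemma card_filter_univ_eq [Fintype H] (h : H) : #{x : H | x = h} = 1 :=
  Finset.card_eq_one.2 ⟨h, by ext; simp⟩

lemma groupRingSum_comp_of_bijOn (s : Finset ι) (f : ι → H) (σ : ι → ι)
    (hσ : Set.BijOn σ s s) : groupRingSum k s (f ∘ σ) = groupRingSum k s f := by
  refine Finset.sum_bij (fun i _ => σ i) (fun i hi => hσ.1 hi) (fun i hi j hj h => hσ.2.1 hi hj h)
    (fun j hj => ?_) (fun _ _ => rfl)
  obtain ⟨i, hi, rfl⟩ := hσ.2.2 hj
  exact ⟨i, hi, rfl⟩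

variable [CommGroup H]

lemma groupRingSum_mul (s : Finset ι) (t : Finset κ) (f : ι → H) (g : κ → H) :
    groupRingSum k s f * groupRingSum k t g
      = groupRingSum k (s ×ˢ t) (fun p => f p.1 * g p.2) := by
  simp [groupRingSum, Finset.sum_mul_sum, Finset.sum_product, MonoidAlgebra.single_mul_single]

lemma groupRingSum_inv [Group ι] (s : Finset ι) (f : ι → H) (hs : ∀ i ∈ s, i⁻¹ ∈ s)
    (hf : ∀ i, f i⁻¹ = (f i)⁻¹) : groupRingSum k s (fun i => (f i)⁻¹) = groupRingSum k s f := by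
  rw [← groupRingSum_comp_of_bijOn s f (fun i => i⁻¹)
    ⟨fun i hi => hs i hi, inv_injective.injOn, fun i hi => ⟨i⁻¹, hs i hi, inv_inv i⟩⟩]
  exact congrArg _ (funext fun i => (hf i).symm)

lemma mapDomain_groupRingSum (φ : H →* H) (s : Finset ι) (f : ι → H) :
    MonoidAlgebra.mapDomainRingHom k φ (groupRingSum k s f) = groupRingSum k s (φ ∘ f) := by
  simp [groupRingSum, map_sum]

lemma groupRingSum_mul_univ [Fintype H] (s : Finset ι) (f : ι → H) :
    groupRingSum k s f * groupRingSum k univ (id : H → H)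
      = (#s : MonoidAlgebra k H) * groupRingSum k univ (id : H → H) := by
  have h (i : ι) : (MonoidAlgebra.single (f i) 1 : MonoidAlgebra k H)
      * groupRingSum k univ (id : H → H) = groupRingSum k univ (id : H → H) := by
    simp only [groupRingSum, Finset.mul_sum, MonoidAlgebra.single_mul_single, mul_one, id]
    exact Fintype.sum_bijective _ (Group.mulLeft_bijective (f i)) _ _ fun _ => rfl
  rw [groupRingSum, Finset.sum_mul, Finset.sum_congr rfl fun i _ => h i]
  simp

lemma coeff_groupRingSum_mul_one (s : Finset ι) (f : ι → H) (x : MonoidAlgebra k H) :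
    (groupRingSum k s f * x).coeff 1 = ∑ i ∈ s, x.coeff (f i)⁻¹ := by
  simp [groupRingSum, Finset.sum_mul, MonoidAlgebra.coeff_sum]

lemma sum_card_fiber_sq [Fintype H] (s : Finset ι) (f : ι → H) :
    ∑ h, (#{i ∈ s | f i = h} : ℤ) ^ 2
      = (groupRingSum ℤ s (fun i => (f i)⁻¹) * groupRingSum ℤ s f).coeff 1 := by
  rw [coeff_groupRingSum_mul_one]
  simp only [inv_inv, coeff_groupRingSum]
  rw [← Finset.sum_fiberwise s f]
  refine Finset.sum_congr rfl fun h _ => ?_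
  rw [Finset.sum_congr rfl (g := fun _ => (#{i ∈ s | f i = h} : ℤ))]
  · simp [sq]
  · intro i hi
    simp [(Finset.mem_filter.1 hi).2]

lemma groupRingSum_pow_three (s : Finset ι) (f : ι → H) :
    groupRingSum (ZMod 3) s f ^ 3 = groupRingSum (ZMod 3) s (fun i => f i ^ 3) := by
  have : CharP (MonoidAlgebra (ZMod 3) H) 3 :=
    charP_of_injective_algebraMap (algebraMap (ZMod 3) (MonoidAlgebra (ZMod 3) H)).injective 3
  have : Fact (Nat.Prime 3) := ⟨Nat.prime_three⟩
  simp [groupRingSum, sum_pow_char, MonoidAlgebra.single_pow]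

lemma pow_bijective_of_coprime_card [Fintype H] {m : ℕ} (hm : (Fintype.card H).Coprime m) :
    Function.Bijective (fun h : H => h ^ m) :=
  (powCoprime (by simpa using hm)).bijective

end GroupRing

section APLL

open Finset

variable {H : Type*} [CommGroup H] [Fintype H]

/-- The hypotheses on an APLL pair, for finite sets. -/
structure IsAPLLPair (n : ℕ) (A B : Finset H) : Prop where
  card_group : Fintype.card H = n ^ 2 + n + 1
  one_mem : 1 ∈ A
  inv_mem_left : ∀ a ∈ A, a⁻¹ ∈ A
  inv_mem_right : ∀ b ∈ B, b⁻¹ ∈ B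
  card_add : #A + #B = 2 * n + 1
  count_mul : ∀ h : H, #{p ∈ A ×ˢ B | p.1 * p.2 = h} = if h = 1 then 0 else 1
  count_sq : ∀ h : H, #{p ∈ A ×ˢ A | p.1 * p.2 = h} + #{p ∈ B ×ˢ B | p.1 * p.2 = h}
    + #{t ∈ A | t ^ 2 = h} + #{t ∈ B | t ^ 2 = h} = 2 + if h = 1 then 2 * n else 0

namespace IsAPLLPair

variable {n : ℕ} {A B : Finset H}

lemma disjoint (P : IsAPLLPair n A B) : Disjoint A B := by
  refine Finset.disjoint_left.2 fun a ha hb => ?_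
  have h := P.count_mul 1
  rw [if_pos rfl, Finset.card_eq_zero] at h
  have : (a, a⁻¹) ∈ ({p ∈ A ×ˢ B | p.1 * p.2 = 1} : Finset (H × H)) := by
    simp [ha, P.inv_mem_right a hb]
  simp [h] at this

lemma one_notMem (P : IsAPLLPair n A B) : 1 ∉ B := Finset.disjoint_left.1 P.disjoint P.one_mem

lemma inv_mem_union (P : IsAPLLPair n A B) (g : H) (hg : g ∈ A ∪ B) : g⁻¹ ∈ A ∪ B := by
  rcases Finset.mem_union.1 hg with h | h
  · exact Finset.mem_union_left _ (P.inv_mem_left g h)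
  · exact Finset.mem_union_right _ (P.inv_mem_right g h)

lemma card_union (P : IsAPLLPair n A B) : #(A ∪ B) = 2 * n + 1 := by
  rw [Finset.card_union_of_disjoint P.disjoint, P.card_add]

lemma coprime_two (P : IsAPLLPair n A B) : (Fintype.card H).Coprime 2 := by
  rw [P.card_group, Nat.coprime_two_right]
  have := Nat.even_mul_succ_self n
  grind

lemma sq_injective (P : IsAPLLPair n A B) : Function.Injective (fun h : H => h ^ 2) :=
  (pow_bijective_of_coprime_card P.coprime_two).1

lemma pow_four_injective (P : IsAPLLPair n A B) : Function.Injective (fun h : H => h ^ 4) := by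
  intro a b h
  apply P.sq_injective
  apply P.sq_injective
  simpa [← pow_mul] using h

lemma cube_injective (P : IsAPLLPair n A B) (hn : n % 6 = 5) :
    Function.Injective (fun h : H => h ^ 3) := by
  refine (pow_bijective_of_coprime_card ?_).1
  rw [P.card_group, Nat.coprime_comm, Nat.Prime.coprime_iff_not_dvd Nat.prime_three]
  obtain ⟨m, rfl⟩ : ∃ m, n = 6 * m + 5 := ⟨n / 6, by omega⟩
  ring_nf
  omega

lemma card_right (P : IsAPLLPair n A B) (hn : n % 6 = 5) : #B = n + 1 := by
  have hev : Even #B := by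
    rw [← ZMod.natCast_eq_zero_iff_even, Finset.cast_card]
    refine Finset.sum_involution (fun b _ => b⁻¹) (fun _ _ => by decide) ?_ P.inv_mem_right
      (fun b _ => inv_inv b)
    intro b hb _ h
    have : b ^ 2 = 1 ^ 2 := by rw [one_pow, sq]; nth_rw 1 [← h]; exact inv_mul_cancel b
    exact P.one_notMem (P.sq_injective this ▸ hb)
  have hprod : #A * #B = n ^ 2 + n := by
    have h := Finset.card_eq_sum_card_fiberwise (s := A ×ˢ B) (t := univ)
      (f := fun p : H × H => p.1 * p.2) (by simp)
    simp only [P.count_mul, Finset.card_product] at h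
    rw [h, ← Finset.sum_erase_add _ _ (mem_univ (1 : H)),
      Finset.sum_congr rfl (g := fun _ => 1) (by simp +contextual)]
    simp [P.card_group]
  have hs := P.card_add
  have : ((#B : ℤ) - n) * ((#B : ℤ) - (n + 1)) = 0 := by
    zify at hprod hs
    have : (#A : ℤ) = 2 * n + 1 - #B := by linarith
    rw [this] at hprod
    linear_combination -hprod
  obtain ⟨m, hm⟩ := hev
  rcases mul_eq_zero.1 this with h | h <;> omega

lemma card_left (P : IsAPLLPair n A B) (hn : n % 6 = 5) : #A = n := by
  have := P.card_add
  have := P.card_right hn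
  omega

section Identities

variable (k : Type*) [CommRing k]

lemma groupRingSum_union (P : IsAPLLPair n A B) (f : H → H) :
    groupRingSum k (A ∪ B) f = groupRingSum k A f + groupRingSum k B f :=
  Finset.sum_union P.disjoint

lemma mul_eq (P : IsAPLLPair n A B) :
    groupRingSum k A id * groupRingSum k B id = groupRingSum k univ id - 1 := by
  ext h
  rw [groupRingSum_mul, MonoidAlgebra.coeff_sub, Finsupp.sub_apply, coeff_groupRingSum,
    coeff_groupRingSum, MonoidAlgebra.one_def, MonoidAlgebra.coeff_single, Finsupp.single_apply]
  simp only [id, P.count_mul]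
  rw [Finset.filter_eq' univ h]
  by_cases hh : h = 1 <;> simp [hh, eq_comm]

lemma sq_add_sq_eq (P : IsAPLLPair n A B) :
    groupRingSum k A id ^ 2 + groupRingSum k B id ^ 2
      = 2 * groupRingSum k univ id - groupRingSum k (A ∪ B) (fun g => g ^ 2)
        + 2 * (n : MonoidAlgebra k H) := by
  rw [P.groupRingSum_union k]
  suffices groupRingSum k A id ^ 2 + groupRingSum k B id ^ 2 + groupRingSum k A (fun g => g ^ 2)
      + groupRingSum k B (fun g => g ^ 2)
      = (2 : k) • groupRingSum k univ id + MonoidAlgebra.single 1 (2 * n : k) by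
    have h2 : (2 : k) • groupRingSum k univ (id : H → H) = 2 * groupRingSum k univ id := by
      rw [two_smul, two_mul]
    have h3 : (MonoidAlgebra.single 1 (2 * n : k) : MonoidAlgebra k H) = 2 * n := by
      rw [show (2 * n : k) = ((2 * n : ℕ) : k) by push_cast; rfl, ← MonoidAlgebra.natCast_def]
      push_cast; rfl
    rw [h2, h3] at this
    linear_combination this
  ext h
  have := congrArg (Nat.cast (R := k)) (P.count_sq h)
  rw [sq, sq, groupRingSum_mul, groupRingSum_mul]
  simp only [MonoidAlgebra.coeff_add, MonoidAlgebra.coeff_smul, Finsupp.add_apply,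
    Finsupp.smul_apply, coeff_groupRingSum, MonoidAlgebra.coeff_single, Finsupp.single_apply, id,
    Finset.filter_eq' univ h]
  push_cast at this
  rw [this]
  by_cases hh : h = 1 <;> simp [hh, eq_comm]

lemma union_sq_eq (P : IsAPLLPair n A B) :
    groupRingSum k (A ∪ B) (fun g => g ^ 2)
      = 4 * groupRingSum k univ id + 2 * (n : MonoidAlgebra k H) - 2 - groupRingSum k (A ∪ B) id ^ 2 := by
  rw [P.groupRingSum_union k id]
  linear_combination P.sq_add_sq_eq k + 2 * P.mul_eq k

lemma union_sq_mul_right_eq (P : IsAPLLPair n A B) (hn : n % 6 = 5) :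
    groupRingSum k (A ∪ B) (fun g => g ^ 2) * groupRingSum k B id
      = ((n : MonoidAlgebra k H) + 2) * groupRingSum k univ id
        + 2 * (n : MonoidAlgebra k H) * groupRingSum k B id + groupRingSum k A id
        - groupRingSum k B id ^ 3 := by
  have hA := groupRingSum_mul_univ (k := k) A (id : H → H)
  have hB := groupRingSum_mul_univ (k := k) B (id : H → H)
  rw [P.card_left hn] at hA
  rw [P.card_right hn] at hB
  push_cast at hB
  linear_combination groupRingSum k B id * P.sq_add_sq_eq k
    - groupRingSum k A id * P.mul_eq k + 2 * hB - hA

lemma union_sq_sq_eq (P : IsAPLLPair n A B) :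
    groupRingSum k (A ∪ B) (fun g => g ^ 2) ^ 2
      = 4 * groupRingSum k univ id + 2 * (n : MonoidAlgebra k H) - 2 - groupRingSum k (A ∪ B) (fun g => g ^ 4) := by
  have h := congrArg (MonoidAlgebra.mapDomainRingHom k (powMonoidHom (α := H) 2)) (P.union_sq_eq k)
  simp only [map_sub, map_add, map_mul, map_pow, map_natCast, map_ofNat,
    mapDomain_groupRingSum] at h
  have huniv : groupRingSum k univ (powMonoidHom (α := H) 2 ∘ id) = groupRingSum k univ id :=
    groupRingSum_comp_of_bijOn univ id (powMonoidHom (α := H) 2)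
      (by simpa [Set.bijOn_univ] using pow_bijective_of_coprime_card P.coprime_two)
  have h4 : powMonoidHom (α := H) 2 ∘ (fun g => g ^ 2) = fun g => g ^ 4 := by
    ext g; simp [← pow_mul]
  have h2 : powMonoidHom (α := H) 2 ∘ id = fun g : H => g ^ 2 := rfl
  rw [huniv, h4, h2] at h
  linear_combination h

end Identities

/-- The coefficient of `h` in the product of the squares of `A ∪ B` with `B`. -/
noncomputable def sqCoeff (A B : Finset H) (h : H) : ℕ :=
  #{p ∈ (A ∪ B) ×ˢ B | p.1 ^ 2 * p.2 = h}

lemma sqCoeff_mod_three (P : IsAPLLPair n A B) (hn : n % 6 = 5) (h : H) :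
    (sqCoeff A B h : ZMod 3)
      = 1 + (if h ∈ A ∪ B then 1 else 0) - (if h ∈ B.image (fun t => t ^ 3) then 1 else 0) := by
  have e := congrArg (fun x => x.coeff h) (P.union_sq_mul_right_eq (ZMod 3) hn)
  have hcoef : (n + 2 : MonoidAlgebra (ZMod 3) H) = 1 ∧ (2 * n : MonoidAlgebra (ZMod 3) H) = 1 := by
    have h3 : (3 : MonoidAlgebra (ZMod 3) H) = 0 := by
      have := congrArg (algebraMap (ZMod 3) (MonoidAlgebra (ZMod 3) H)) (by decide : (3 : ZMod 3) = 0)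
      simpa only [map_ofNat, map_zero] using this
    obtain ⟨m, rfl⟩ : ∃ m, n = 6 * m + 5 := ⟨n / 6, by omega⟩
    push_cast
    constructor
    · linear_combination (2 * m + 2 : MonoidAlgebra (ZMod 3) H) * h3
    · linear_combination (4 * m + 3 : MonoidAlgebra (ZMod 3) H) * h3
  rw [hcoef.1, hcoef.2, one_mul, one_mul, groupRingSum_pow_three, groupRingSum_mul,
    add_assoc, add_comm (groupRingSum _ B _), ← P.groupRingSum_union (ZMod 3)] at e
  simp only [MonoidAlgebra.coeff_add, MonoidAlgebra.coeff_sub, Finsupp.add_apply,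
    Finsupp.sub_apply, coeff_groupRingSum, id] at e
  rw [sqCoeff, e, card_filter_univ_eq, card_filter_eq_of_injective (P.cube_injective hn),
    card_filter_eq_of_injective (f := fun x : H => x) Function.injective_id, Finset.image_id']
  push_cast
  rfl

lemma sum_sqCoeff (P : IsAPLLPair n A B) (hn : n % 6 = 5) :
    ∑ h, sqCoeff A B h = (2 * n + 1) * (n + 1) := by
  simp only [sqCoeff]
  rw [← Finset.card_eq_sum_card_fiberwise (s := (A ∪ B) ×ˢ B) (t := univ)
      (f := fun p : H × H => p.1 ^ 2 * p.2) (by simp), Finset.card_product, P.card_union,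
      P.card_right hn]

lemma count_right_eq (P : IsAPLLPair n A B) {h : H} (hh : h ≠ 1) :
    #{p ∈ B ×ˢ B | p.1 * p.2 = h} = (if h ∈ B.image (fun t => t ^ 2) then 1 else 0)
      + 2 * if h ∈ (B * B) \ (B.image (fun t => t ^ 2) ∪ {1}) then 1 else 0 := by
  have e := P.count_sq h
  rw [if_neg hh] at e
  by_cases h2 : h ∈ B.image (fun t => t ^ 2)
  · obtain ⟨t, ht, rfl⟩ := Finset.mem_image.1 h2
    have h3 : 0 < #{p ∈ B ×ˢ B | p.1 * p.2 = t ^ 2} :=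
      Finset.card_pos.2 ⟨(t, t), by simp [ht, sq]⟩
    have h4 : 0 < #{s ∈ B | s ^ 2 = t ^ 2} := Finset.card_pos.2 ⟨t, by simp [ht]⟩
    simp only [h2, if_true, Finset.mem_sdiff, Finset.mem_union, true_or, not_true, and_false,
      if_false]
    omega
  · by_cases h3 : h ∈ B * B
    · obtain ⟨x, hx, y, hy, rfl⟩ := Finset.mem_mul.1 h3
      have hxy : x ≠ y := by
        rintro rfl
        exact h2 (Finset.mem_image.2 ⟨x, hx, sq x⟩)
      have : #({(x, y), (y, x)} : Finset (H × H)) ≤ #{p ∈ B ×ˢ B | p.1 * p.2 = x * y} := by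
        refine Finset.card_le_card fun p hp => ?_
        simp only [Finset.mem_insert, Finset.mem_singleton] at hp
        rcases hp with rfl | rfl <;> simp [hx, hy, mul_comm]
      rw [Finset.card_pair (by simp [hxy])] at this
      simp only [h2, h3, if_false, Finset.mem_sdiff, Finset.mem_union, Finset.mem_singleton, hh,
        or_self, not_false_eq_true, and_self, if_true]
      omega
    · have : #{p ∈ B ×ˢ B | p.1 * p.2 = h} = 0 := by
        rw [Finset.card_eq_zero, Finset.filter_eq_empty_iff]
        rintro ⟨x, y⟩ hp rfl
        rw [Finset.mem_product] at hp
        exact h3 (Finset.mul_mem_mul hp.1 hp.2)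
      simp [h2, h3, this]

lemma count_right_one (P : IsAPLLPair n A B) : #{p ∈ B ×ˢ B | p.1 * p.2 = 1} = #B := by
  refine (Finset.card_bij (fun b _ => (b, b⁻¹)) (fun b hb => ?_) (fun a _ b _ h => ?_) ?_).symm
  · simp [hb, P.inv_mem_right b hb]
  · exact (Prod.ext_iff.1 h).1
  · rintro ⟨x, y⟩ h
    simp only [Finset.mem_filter, Finset.mem_product] at h
    exact ⟨x, h.1.1, by rw [inv_eq_of_mul_eq_one_right h.2]⟩

/-- Twice the quantity `θ₁`, for finite sets. -/
noncomputable def twoTheta (A B : Finset H) : ℕ :=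
  #(B ∩ (A ∪ B).image (fun g => g ^ 2))
    + 2 * #(((B * B) \ (B.image (fun t => t ^ 2) ∪ {1})) ∩ (A ∪ B).image (fun g => g ^ 4))

lemma sum_count_right (P : IsAPLLPair n A B) (hn : n % 6 = 5) :
    ∑ g ∈ A ∪ B, #{p ∈ B ×ˢ B | p.1 * p.2 = g ^ 4} = n + 1 + twoTheta A B := by
  have hone : (1 : H) ∈ A ∪ B := Finset.mem_union_left _ P.one_mem
  have h1 : (1 : H) ∉ B.image (fun t => t ^ 2) := by
    intro h
    obtain ⟨t, ht, e⟩ := Finset.mem_image.1 h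
    have : t = 1 := P.sq_injective (by simpa using e)
    exact P.one_notMem (this ▸ ht)
  have hg (g : H) : #{p ∈ B ×ˢ B | p.1 * p.2 = g ^ 4} = (if g = 1 then n + 1 else 0)
      + ((if g ^ 4 ∈ B.image (fun t => t ^ 2) then 1 else 0)
      + 2 * if g ^ 4 ∈ (B * B) \ (B.image (fun t => t ^ 2) ∪ {1}) then 1 else 0) := by
    by_cases h : g = 1
    · subst h
      rw [one_pow, P.count_right_one, P.card_right hn]
      simp [h1]
    · rw [if_neg h, zero_add]
      refine P.count_right_eq fun e => h (P.pow_four_injective (by simpa using e))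
  have hind (S : Finset H) : ∑ g ∈ A ∪ B, (if g ^ 4 ∈ S then 1 else 0)
      = #(S ∩ (A ∪ B).image (fun g => g ^ 4)) := by
    rw [← Finset.card_filter, ← Finset.card_image_of_injective _ P.pow_four_injective]
    congr 1
    ext x
    simp only [Finset.mem_image, Finset.mem_filter, Finset.mem_inter]
    grind
  have hsq : #(B.image (fun t => t ^ 2) ∩ (A ∪ B).image (fun g => g ^ 4))
      = #(B ∩ (A ∪ B).image (fun g => g ^ 2)) := by
    rw [← Finset.card_image_of_injective (B ∩ _) P.sq_injective,
      Finset.image_inter _ _ P.sq_injective, Finset.image_image]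
    congr 3
    ext g
    simp [← pow_mul]
  rw [Finset.sum_congr rfl fun g _ => hg g, Finset.sum_add_distrib, Finset.sum_add_distrib,
    ← Finset.mul_sum, hind, hind, hsq, twoTheta, Finset.sum_ite_eq', if_pos hone]

lemma sum_sqCoeff_sq (P : IsAPLLPair n A B) (hn : n % 6 = 5) :
    ∑ h, (sqCoeff A B h : ℤ) ^ 2 = 6 * n ^ 2 + 7 * n + 1 - twoTheta A B := by
  have hinv : ∀ p ∈ (A ∪ B) ×ˢ B, p⁻¹ ∈ (A ∪ B) ×ˢ B := by
    rintro ⟨x, y⟩ h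
    rw [Finset.mem_product] at h
    exact Finset.mem_product.2 ⟨P.inv_mem_union _ h.1, P.inv_mem_right _ h.2⟩
  have hB := groupRingSum_mul_univ (k := ℤ) B (id : H → H)
  rw [P.card_right hn] at hB
  push_cast at hB
  simp only [sqCoeff]
  rw [sum_card_fiber_sq, groupRingSum_inv _ _ hinv (by simp [mul_comm])]
  have e : groupRingSum ℤ ((A ∪ B) ×ˢ B) (fun p => p.1 ^ 2 * p.2)
      = groupRingSum ℤ (A ∪ B) (fun g => g ^ 2) * groupRingSum ℤ B id := by
    rw [groupRingSum_mul]; rfl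
  have e2 : groupRingSum ℤ ((A ∪ B) ×ˢ B) (fun p => p.1 ^ 2 * p.2)
      * groupRingSum ℤ ((A ∪ B) ×ˢ B) (fun p => p.1 ^ 2 * p.2)
      = (4 * (n + 1) ^ 2 : ℤ) • groupRingSum ℤ univ id
        + (2 * n - 2 : ℤ) • (groupRingSum ℤ B id * groupRingSum ℤ B id)
        - groupRingSum ℤ (A ∪ B) (fun g => g ^ 4)
          * (groupRingSum ℤ B id * groupRingSum ℤ B id) := by
    rw [e, zsmul_eq_mul, zsmul_eq_mul]
    push_cast
    linear_combination groupRingSum ℤ B id ^ 2 * P.union_sq_sq_eq ℤ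
      + 4 * (groupRingSum ℤ B id + n + 1) * hB
  have hsum : ∑ g ∈ A ∪ B, (#{p ∈ B ×ˢ B | p.1 * p.2 = (g ^ 4)⁻¹} : ℤ)
      = n + 1 + twoTheta A B := by
    rw [Finset.sum_bij' (t := A ∪ B) (g := fun g => (#{p ∈ B ×ˢ B | p.1 * p.2 = g ^ 4} : ℤ))
      (fun g _ => g⁻¹) (fun g _ => g⁻¹) P.inv_mem_union P.inv_mem_union (by simp) (by simp)
      (by simp)]
    exact_mod_cast P.sum_count_right hn
  rw [e2, MonoidAlgebra.coeff_sub, Finsupp.sub_apply, coeff_groupRingSum_mul_one]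
  simp only [groupRingSum_mul, MonoidAlgebra.coeff_add, MonoidAlgebra.coeff_smul,
    Finsupp.add_apply, Finsupp.smul_apply, coeff_groupRingSum, id, hsum, P.count_right_one,
    P.card_right hn, card_filter_univ_eq, smul_eq_mul]
  push_cast
  ring

/-- The number of elements of `A ∪ B` that are cubes of elements of `B`. -/
noncomputable def cubeCount (A B : Finset H) : ℕ :=
  #((A ∪ B) ∩ B.image (fun t => t ^ 3))

lemma sqCoeff_mod_three_eq_zero_iff (P : IsAPLLPair n A B) (hn : n % 6 = 5) (h : H) :
    sqCoeff A B h % 3 = 0 ↔ h ∈ B.image (fun t => t ^ 3) \ (A ∪ B) := by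
  have e := P.sqCoeff_mod_three hn h
  rw [← Nat.dvd_iff_mod_eq_zero, ← ZMod.natCast_eq_zero_iff, e, Finset.mem_sdiff]
  split_ifs with h1 h2 h2 <;> simp only [h1, h2] <;> decide

lemma sqCoeff_mod_three_eq_two_iff (P : IsAPLLPair n A B) (hn : n % 6 = 5) (h : H) :
    sqCoeff A B h % 3 = 2 ↔ h ∈ (A ∪ B) \ B.image (fun t => t ^ 3) := by
  have e := P.sqCoeff_mod_three hn h
  rw [show sqCoeff A B h % 3 = 2 ↔ sqCoeff A B h % 3 = 2 % 3 from Iff.rfl,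
    ← Nat.ModEq, ← ZMod.natCast_eq_natCast_iff, e, Finset.mem_sdiff]
  split_ifs with h1 h2 h2 <;> simp only [h1, h2] <;> decide

lemma card_sqCoeff_mod_three_eq_zero (P : IsAPLLPair n A B) (hn : n % 6 = 5) :
    #{h | sqCoeff A B h % 3 = 0} + cubeCount A B = n + 1 := by
  simp only [P.sqCoeff_mod_three_eq_zero_iff hn, cubeCount]
  rw [Finset.filter_univ_mem, Finset.inter_comm, Finset.card_sdiff_add_card_inter,
    Finset.card_image_of_injective _ (P.cube_injective hn), P.card_right hn]

lemma card_sqCoeff_mod_three_eq_two (P : IsAPLLPair n A B) (hn : n % 6 = 5) :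
    #{h | sqCoeff A B h % 3 = 2} + cubeCount A B = 2 * n + 1 := by
  simp only [P.sqCoeff_mod_three_eq_two_iff hn, cubeCount]
  rw [Finset.filter_univ_mem, Finset.card_sdiff_add_card_inter, P.card_union]

end IsAPLLPair

end APLL

section Weights

/-- The coefficient `sCoef i`, set to zero for `i < 5`. -/
def sWeight (i : ℕ) : ℚ := if 5 ≤ i then sCoef i else 0

lemma three_ite_zero_add_sWeight (i : ℕ) :
    3 * (if i = 0 then 1 else 0) + sWeight i
      = ((i : ℚ) ^ 2 - 5 * i + 4) / 2 + (if i % 3 = 0 then 1 else 0)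
        + (if i % 3 = 2 then 1 else 0) := by
  rcases lt_or_ge i 5 with h | h
  · interval_cases i <;> norm_num [sWeight, sCoef]
  · have h3 : i % 3 = 0 ∨ i % 3 = 1 ∨ i % 3 = 2 := by omega
    have h0 : i ≠ 0 := by omega
    rcases h3 with h3 | h3 | h3 <;> simp [sWeight, sCoef, h, h0, h3] <;> ring

lemma weight_bounds (i : ℕ) :
    (4 - (i : ℚ) - 2 * (if i % 3 = 2 then 1 else 0) - (if i % 3 = 0 then 1 else 0)
        - 3 * (if i = 0 then 1 else 0) ≤ 3 * (if i = 1 then 1 else 0) ∧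
      3 * (if i = 1 then 1 else 0) ≤ 4 - (i : ℚ) - 2 * (if i % 3 = 2 then 1 else 0)
        - (if i % 3 = 0 then 1 else 0) + sWeight i) ∧
    ((i : ℚ) - 1 - (if i % 3 = 2 then 1 else 0) - 2 * (if i % 3 = 0 then 1 else 0)
        - sWeight i ≤ 3 * (if i = 4 then 1 else 0) ∧
      3 * (if i = 4 then 1 else 0) ≤ (i : ℚ) - 1 - (if i % 3 = 2 then 1 else 0)
        - 2 * (if i % 3 = 0 then 1 else 0) + 3 * (if i = 0 then 1 else 0)) ∧
    0 ≤ sWeight i := by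
  rcases lt_or_ge i 5 with h | h
  · interval_cases i <;> norm_num [sWeight, sCoef]
  · have h3 : i % 3 = 0 ∨ i % 3 = 1 ∨ i % 3 = 2 := by omega
    have h0 : i ≠ 0 := by omega
    have h1 : i ≠ 1 := by omega
    have h4 : i ≠ 4 := by omega
    have h5 : (5 : ℚ) ≤ i := by exact_mod_cast h
    rcases h3 with h3 | h3 | h3
    · simp only [sWeight, sCoef, h, h0, h1, h4, h3]
      norm_num
      refine ⟨⟨?_, ?_⟩, ⟨?_, ?_⟩, ?_⟩ <;> nlinarith
    · have h7 : (7 : ℚ) ≤ i := by exact_mod_cast (by omega : 7 ≤ i)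
      simp only [sWeight, sCoef, h, h0, h1, h4, h3]
      norm_num
      refine ⟨⟨?_, ?_⟩, ⟨?_, ?_⟩, ?_⟩ <;> nlinarith
    · simp only [sWeight, sCoef, h, h0, h1, h4, h3]
      norm_num
      refine ⟨⟨?_, ?_⟩, ⟨?_, ?_⟩, ?_⟩ <;> nlinarith

lemma tsum_mul_card_fiber {X : Type*} [Fintype X] (y : X → ℕ) (F : ℕ → ℚ) :
    ∑' i, F i * ({x | y x = i} : Set X).ncard = ∑ x, F (y x) := by
  rw [Finset.sum_comp, tsum_eq_sum (s := Finset.univ.image y)]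
  · refine Finset.sum_congr rfl fun i _ => ?_
    rw [nsmul_eq_mul, mul_comm, Set.ncard_eq_toFinset_card']
    congr 3
    ext
    simp
  · intro i hi
    have : ({x | y x = i} : Set X) = ∅ := by
      ext x
      simp only [Set.mem_ofPred_eq, Set.mem_empty_iff_false, iff_false]
      rintro rfl
      exact hi (Finset.mem_image_of_mem y (Finset.mem_univ x))
    simp [this]

end Weights

section Translation

open Finset

variable {H : Type*} [CommGroup H] [Fintype H] {n : ℕ} {T₀ T₁ : Set H}

lemma ncard_setOf_eq_card_filter {X : Type*} {s : Finset X} {p q : X → Prop}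
    (h : ∀ x, p x ↔ x ∈ s ∧ q x) : {x | p x}.ncard = #{x ∈ s | q x} := by
  rw [← Set.ncard_coe_finset]
  congr 1
  ext x
  simp [h]

lemma IsAPLLPair.of_eqs (hcard : Fintype.card H = n ^ 2 + n + 1) (hT₀inv : T₀⁻¹ = T₀)
    (hT₁inv : T₁⁻¹ = T₁) (he : (1 : H) ∈ T₀) (hk : T₀.ncard + T₁.ncard = 2 * n + 1)
    (hAPLL : APLLEqs n T₀ T₁) : IsAPLLPair n T₀.toFinset T₁.toFinset where
  card_group := hcard
  one_mem := by simpa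
  inv_mem_left a ha := by
    rw [Set.mem_toFinset] at *
    rw [← hT₀inv]
    simpa
  inv_mem_right a ha := by
    rw [Set.mem_toFinset] at *
    rw [← hT₁inv]
    simpa
  card_add := by rw [← Set.ncard_eq_toFinset_card', ← Set.ncard_eq_toFinset_card', hk]
  count_mul h := by
    rw [← hAPLL.1 h]
    exact (ncard_setOf_eq_card_filter fun p => by simp [and_assoc]).symm
  count_sq h := by
    rw [← hAPLL.2 h]
    refine (congrArg₂ _ (congrArg₂ _ (congrArg₂ _ ?_ ?_) ?_) ?_).symm <;>
      exact ncard_setOf_eq_card_filter fun p => by simp [and_assoc]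

lemma Yset_eq (i : ℕ) :
    Yset T₀ T₁ i = {h | IsAPLLPair.sqCoeff T₀.toFinset T₁.toFinset h = i} := by
  ext h
  rw [Yset, Set.mem_ofPred_eq, Set.mem_ofPred_eq, IsAPLLPair.sqCoeff,
    ncard_setOf_eq_card_filter (s := (T₀.toFinset ∪ T₁.toFinset) ×ˢ T₁.toFinset)
      (q := fun p : H × H => p.1 ^ 2 * p.2 = h) fun p => by simp; tauto]

lemma ncard_Yset (i : ℕ) : ((Yset T₀ T₁ i).ncard : ℚ)
    = ∑ h, if IsAPLLPair.sqCoeff T₀.toFinset T₁.toFinset h = i then 1 else 0 := by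
  rw [Yset_eq, Finset.sum_boole, Set.ncard_eq_toFinset_card']
  congr 2
  ext
  simp

lemma theta1_eq : theta1 T₀ T₁ = (IsAPLLPair.twoTheta T₀.toFinset T₁.toFinset : ℚ) / 2 := by
  rw [theta1, IsAPLLPair.twoTheta, ← Set.ncard_coe_finset, ← Set.ncard_coe_finset]
  push_cast
  simp only [Set.coe_toFinset]
  ring

lemma cubeCount_eq (hd : Disjoint T₀ T₁) : IsAPLLPair.cubeCount T₀.toFinset T₁.toFinset
    = (T₀ ∩ ((fun t => t ^ 3) '' T₁)).ncard + (T₁ ∩ ((fun t => t ^ 3) '' T₁)).ncard := by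
  rw [IsAPLLPair.cubeCount, ← Set.ncard_coe_finset, ← Set.ncard_union_eq
    (hd.mono Set.inter_subset_left Set.inter_subset_left)]
  push_cast
  simp only [Set.coe_toFinset, Set.union_inter_distrib_right]

end Translation

/-- For `n ≡ 5 (mod 6)`, bounds on `|Y₀|`, `Σ_{i≥5} s_i|Y_i|`, `|Y₁|` and `|Y₄|`
in terms of `u = |T₀ ∩ T₁⁽³⁾| + |T₁ ∩ T₁⁽³⁾|` and `θ₁`, as inequalities of
rational numbers. -/
theorem Yi_bounds_n_eq_five_mod_six (n : ℕ) (hn : 0 < n) (hmod : n % 6 = 5)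
    {H : Type*} [CommGroup H] [Fintype H]
    (hcard : Fintype.card H = n ^ 2 + n + 1)
    (T₀ T₁ : Set H) (hT₀inv : T₀⁻¹ = T₀) (hT₁inv : T₁⁻¹ = T₁)
    (he : (1 : H) ∈ T₀) (hk : T₀.ncard + T₁.ncard = 2 * n + 1)
    (hAPLL : APLLEqs n T₀ T₁)
    (u : ℕ)
    (hu : u = (T₀ ∩ ((fun t => t ^ 3) '' T₁)).ncard
        + (T₁ ∩ ((fun t => t ^ 3) '' T₁)).ncard) :
    3 * ((Yset T₀ T₁ 0).ncard : ℚ) ≤ (n : ℚ) - 2 * u + 2 - theta1 T₀ T₁ ∧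
    (∑' i : ℕ, if 5 ≤ i then sCoef i * ((Yset T₀ T₁ i).ncard : ℚ) else 0)
      ≤ (n : ℚ) - 2 * u + 2 - theta1 T₀ T₁ ∧
    (2 * (n : ℚ) ^ 2 - 6 * n + 7 * u - 4 + 2 * theta1 T₀ T₁
        ≤ 3 * ((Yset T₀ T₁ 1).ncard : ℚ) ∧
      3 * ((Yset T₀ T₁ 1).ncard : ℚ)
        ≤ 2 * (n : ℚ) ^ 2 - 2 * n - u + 4 - 2 * theta1 T₀ T₁) ∧
    ((n : ℚ) ^ 2 - 4 * n + 7 * u - 7 + 2 * theta1 T₀ T₁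
        ≤ 3 * ((Yset T₀ T₁ 4).ncard : ℚ) ∧
      3 * ((Yset T₀ T₁ 4).ncard : ℚ)
        ≤ (n : ℚ) ^ 2 - n + u - 1 - theta1 T₀ T₁) := by
  have P := IsAPLLPair.of_eqs hcard hT₀inv hT₁inv he hk hAPLL
  rw [← cubeCount_eq (by simpa [Set.disjoint_toFinset] using P.disjoint)] at hu
  have hw : (∑' i : ℕ, if 5 ≤ i then sCoef i * ((Yset T₀ T₁ i).ncard : ℚ) else 0)
      = ∑ h, sWeight (IsAPLLPair.sqCoeff T₀.toFinset T₁.toFinset h) := by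
    rw [← tsum_mul_card_fiber]
    refine tsum_congr fun i => ?_
    rw [Yset_eq, sWeight, ite_mul, zero_mul]
  have hc0 := P.card_sqCoeff_mod_three_eq_zero hmod
  have hc2 := P.card_sqCoeff_mod_three_eq_two hmod
  have hm1 := P.sum_sqCoeff hmod
  have hm2 := P.sum_sqCoeff_sq hmod
  rw [hw, ncard_Yset, ncard_Yset, ncard_Yset, theta1_eq]
  rw [← hu] at hc0 hc2
  generalize IsAPLLPair.sqCoeff T₀.toFinset T₁.toFinset = y at *
  generalize IsAPLLPair.twoTheta T₀.toFinset T₁.toFinset = θ at *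
  have hc0' : ∑ h, (if y h % 3 = 0 then 1 else 0 : ℚ) = n + 1 - u := by
    rw [Finset.sum_boole, eq_sub_iff_add_eq]
    exact_mod_cast hc0
  have hc2' : ∑ h, (if y h % 3 = 2 then 1 else 0 : ℚ) = 2 * n + 1 - u := by
    rw [Finset.sum_boole, eq_sub_iff_add_eq]
    exact_mod_cast hc2
  have hm1' : ∑ h, (y h : ℚ) = (2 * n + 1) * (n + 1) := by exact_mod_cast hm1
  have hm2' : ∑ h, (y h : ℚ) ^ 2 = 6 * n ^ 2 + 7 * n + 1 - θ := by exact_mod_cast hm2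
  have hm0 : (Fintype.card H : ℚ) = n ^ 2 + n + 1 := by exact_mod_cast hcard
  have hR := Finset.sum_congr rfl fun h (_ : h ∈ Finset.univ) => three_ite_zero_add_sWeight (y h)
  have h1l := Finset.sum_le_sum fun h (_ : h ∈ Finset.univ) => (weight_bounds (y h)).1.1
  have h1u := Finset.sum_le_sum fun h (_ : h ∈ Finset.univ) => (weight_bounds (y h)).1.2
  have h4l := Finset.sum_le_sum fun h (_ : h ∈ Finset.univ) => (weight_bounds (y h)).2.1.1
  have h4u := Finset.sum_le_sum fun h (_ : h ∈ Finset.univ) => (weight_bounds (y h)).2.1.2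
  have hw0 := Finset.sum_nonneg fun h (_ : h ∈ Finset.univ) => (weight_bounds (y h)).2.2
  have hy0 : 0 ≤ ∑ h, (if y h = 0 then 1 else 0 : ℚ) :=
    Finset.sum_nonneg fun h _ => by split_ifs <;> norm_num
  simp only [Finset.sum_add_distrib, Finset.sum_sub_distrib, ← Finset.mul_sum, ← Finset.sum_div,
    Finset.sum_const, Finset.card_univ, nsmul_eq_mul, hc0', hc2', hm1', hm2', hm0]
    at hR h1l h1u h4l h4u
  refine ⟨?_, ?_, ⟨?_, ?_⟩, ?_, ?_⟩ <;> linarith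
end

section
/- Let n be a positive integer, H a finite abelian group of order n²+n+1, and T₀, T₁ inverse-closed subsets of H with e ∈ T₀ satisfying the APLL group-ring equations. Set k₀ = |T₀|, k₁ = |T₁| and T̂ = T₀ + T₁ ∈ ℤ[H]. Then the following identities hold in ℤ[H]: T̂^{(4)}·T₀ = (5k₀ + (2k₀ − k₁)(k₀² − 1))·H + (4n² + 2n − 3)·T₀ + 2n·T₁ − 4n·T̂^{(2)}·T₀ − T̂^{(2)}·T₁ − T₀⁵, and T̂^{(4)}·T₁ = (5k₁ + (2k₁ − k₀)(k₁² − 1))·H + (4n² + 2n − 3)·T₁ + 2n·T₀ − 4n·T̂^{(2)}·T₁ − T̂^{(2)}·T₀ − T₁⁵. -/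
/-- The group-ring element `T⁽ʲ⁾ = Σ_{t∈T} tʲ ∈ ℤ[H]` attached to a finite subset
`T` of `H`. -/
noncomputable def setPowElm {H : Type*} [CommGroup H] (T : Finset H) (j : ℕ) :
    MonoidAlgebra ℤ H :=
  ∑ t ∈ T, MonoidAlgebra.of ℤ H (t ^ j)

/-- The group-ring element `H = Σ_{h∈H} h ∈ ℤ[H]`. -/
noncomputable def grpElm (H : Type*) [CommGroup H] [Fintype H] : MonoidAlgebra ℤ H :=
  ∑ h : H, MonoidAlgebra.of ℤ H h

/-- The multiplier map `g ↦ g ^ j` on `ℤ[H]`. -/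
noncomputable def powRingHom (H : Type*) [CommGroup H] (j : ℕ) :
    MonoidAlgebra ℤ H →+* MonoidAlgebra ℤ H :=
  MonoidAlgebra.mapDomainRingHom ℤ (powMonoidHom j : H →* H)

lemma powRingHom_setPowElm {H : Type*} [CommGroup H] (T : Finset H) (i j : ℕ) :
    powRingHom H j (setPowElm T i) = setPowElm T (i * j) := by
  simp [powRingHom, setPowElm, map_sum, pow_mul]

lemma powRingHom_grpElm {H : Type*} [CommGroup H] [Fintype H] {j : ℕ}
    (hj : (Nat.card H).Coprime j) : powRingHom H j (grpElm H) = grpElm H := by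
  simp only [powRingHom, grpElm, map_sum, MonoidAlgebra.of_apply,
    MonoidAlgebra.mapDomainRingHom_apply, MonoidAlgebra.mapDomain_single, powMonoidHom_apply]
  exact (powCoprime hj).sum_comp fun h ↦ MonoidAlgebra.single h (1 : ℤ)

lemma of_mul_grpElm {H : Type*} [CommGroup H] [Fintype H] (t : H) :
    MonoidAlgebra.of ℤ H t * grpElm H = grpElm H := by
  simp only [grpElm, Finset.mul_sum, ← map_mul]
  exact Equiv.sum_comp (Equiv.mulLeft t) fun h ↦ MonoidAlgebra.of ℤ H h

lemma setPowElm_mul_grpElm {H : Type*} [CommGroup H] [Fintype H] (T : Finset H) (j : ℕ) :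
    setPowElm T j * grpElm H = (T.card : MonoidAlgebra ℤ H) * grpElm H := by
  simp only [setPowElm, Finset.sum_mul, of_mul_grpElm, Finset.sum_const, nsmul_eq_mul]

/-- The augmentation map `ℤ[H] → ℤ`. -/
noncomputable def augmentation (H : Type*) [CommGroup H] : MonoidAlgebra ℤ H →ₐ[ℤ] ℤ :=
  MonoidAlgebra.lift ℤ ℤ H (1 : H →* ℤ)

lemma augmentation_setPowElm {H : Type*} [CommGroup H] (T : Finset H) (j : ℕ) :
    augmentation H (setPowElm T j) = T.card := by
  simp [augmentation, setPowElm, map_sum]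

lemma augmentation_grpElm {H : Type*} [CommGroup H] [Fintype H] :
    augmentation H (grpElm H) = Fintype.card H := by
  simp [augmentation, grpElm, map_sum]

/-- The elimination behind `hatT4_identities`, in an arbitrary commutative ring. -/
lemma hatT4_mul_eq {R : Type*} [CommRing R] {A B G S S' a b n : R}
    (hAB : A * B = G - 1) (hsq : A ^ 2 + B ^ 2 = 2 * G - S + 2 * n)
    (hS : S ^ 2 = 4 * G - S' + 2 * n - 2) (hA : A * G = a * G) (hB : B * G = b * G)
    (hSG : S * G = (a + b) * G) (hab : a + b = 2 * n + 1) :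
    S' * A = (5 * a + (2 * a - b) * (a ^ 2 - 1)) * G + (4 * n ^ 2 + 2 * n - 3) * A
      + 2 * n * B - 4 * n * (S * A) - S * B - A ^ 5 := by
  have hSA : S * A = (2 * a - b) * G + 2 * n * A - A ^ 3 + B := by
    linear_combination A * hsq + 2 * hA - hB - B * hAB
  have hA2 : A ^ 2 * G = a ^ 2 * G := by linear_combination (A + a) * hA
  have hSA3 : S * A ^ 3 = a ^ 2 * (2 * a - b) * G + 2 * n * A ^ 3 - A ^ 5 + a * G - A := by
    linear_combination A ^ 2 * hSA + (2 * a - b) * hA2 + A * hAB + hA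
  linear_combination A * hS + 4 * hA - S * hSA - (2 * a - b) * hSG + hSA3
    + 2 * n * hSA - (2 * a - b) * G * hab

/-- The two group-ring identities for `T̂⁽⁴⁾T₀` and `T̂⁽⁴⁾T₁` in `ℤ[H]` that follow
from the APLL group-ring equations `T₀T₁ = H − e` and
`T₀² + T₁² = 2H − T₀⁽²⁾ − T₁⁽²⁾ + 2n·e`. -/
theorem hatT4_identities (n : ℕ) (hn : 0 < n)
    {H : Type*} [CommGroup H] [Fintype H]
    (hcard : Fintype.card H = n ^ 2 + n + 1)
    (T₀ T₁ : Finset H)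
    (hT₀inv : ∀ t : H, t ∈ T₀ ↔ t⁻¹ ∈ T₀) (hT₁inv : ∀ t : H, t ∈ T₁ ↔ t⁻¹ ∈ T₁)
    (he : (1 : H) ∈ T₀)
    (heq1 : setPowElm T₀ 1 * setPowElm T₁ 1 = grpElm H - 1)
    (heq2 : setPowElm T₀ 1 ^ 2 + setPowElm T₁ 1 ^ 2
      = (2 : ℤ) • grpElm H - setPowElm T₀ 2 - setPowElm T₁ 2
        + (2 * (n : ℤ)) • (1 : MonoidAlgebra ℤ H)) :
    (setPowElm T₀ 4 + setPowElm T₁ 4) * setPowElm T₀ 1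
      = (5 * (T₀.card : ℤ)
            + (2 * (T₀.card : ℤ) - (T₁.card : ℤ)) * ((T₀.card : ℤ) ^ 2 - 1)) • grpElm H
        + (4 * (n : ℤ) ^ 2 + 2 * n - 3) • setPowElm T₀ 1
        + (2 * (n : ℤ)) • setPowElm T₁ 1
        - (4 * (n : ℤ)) • ((setPowElm T₀ 2 + setPowElm T₁ 2) * setPowElm T₀ 1)
        - (setPowElm T₀ 2 + setPowElm T₁ 2) * setPowElm T₁ 1
        - setPowElm T₀ 1 ^ 5 ∧
    (setPowElm T₀ 4 + setPowElm T₁ 4) * setPowElm T₁ 1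
      = (5 * (T₁.card : ℤ)
            + (2 * (T₁.card : ℤ) - (T₀.card : ℤ)) * ((T₁.card : ℤ) ^ 2 - 1)) • grpElm H
        + (4 * (n : ℤ) ^ 2 + 2 * n - 3) • setPowElm T₁ 1
        + (2 * (n : ℤ)) • setPowElm T₀ 1
        - (4 * (n : ℤ)) • ((setPowElm T₀ 2 + setPowElm T₁ 2) * setPowElm T₁ 1)
        - (setPowElm T₀ 2 + setPowElm T₁ 2) * setPowElm T₀ 1
        - setPowElm T₁ 1 ^ 5 := by
  have hodd : (Nat.card H).Coprime 2 := by
    rw [Nat.card_eq_fintype_card, hcard, Nat.coprime_two_right, sq, ← Nat.mul_succ]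
    exact (Nat.even_mul_succ_self n).add_one
  have hψ1 := congrArg (powRingHom H 2) heq1
  have hψ2 := congrArg (powRingHom H 2) heq2
  have hε1 := congrArg (augmentation H) heq1
  have hε2 := congrArg (augmentation H) heq2
  simp only [map_mul, map_add, map_sub, map_pow, map_one, powRingHom_setPowElm,
    powRingHom_grpElm hodd, one_mul, Nat.reduceMul, augmentation_setPowElm, augmentation_grpElm,
    hcard, zsmul_eq_mul, Nat.cast_add, Nat.cast_pow, Nat.cast_one] at hψ1 hψ2 hε1 hε2
  push_cast [map_mul, map_ofNat, map_natCast] at hψ2 hε1 hε2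
  have hsum : (T₀.card : ℤ) + T₁.card = 2 * n + 1 := by
    have h : ((T₀.card : ℤ) + T₁.card - (2 * n + 1)) * (T₀.card + T₁.card + 2 * n + 2) = 0 := by
      linear_combination 2 * hε1 + hε2
    rcases mul_eq_zero.mp h with h | h
    · linarith
    · lia
  have hab : (T₀.card : MonoidAlgebra ℤ H) + T₁.card = 2 * n + 1 := by
    exact_mod_cast congrArg (Int.cast : ℤ → MonoidAlgebra ℤ H) hsum
  have hS : (setPowElm T₀ 2 + setPowElm T₁ 2) ^ 2
      = 4 * grpElm H - (setPowElm T₀ 4 + setPowElm T₁ 4) + 2 * (n : MonoidAlgebra ℤ H) - 2 := by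
    linear_combination 2 * hψ1 + hψ2
  have hSG : (setPowElm T₀ 2 + setPowElm T₁ 2) * grpElm H
      = (T₀.card + T₁.card : MonoidAlgebra ℤ H) * grpElm H := by
    rw [add_mul, setPowElm_mul_grpElm, setPowElm_mul_grpElm, add_mul]
  have hA := setPowElm_mul_grpElm T₀ 1
  have hB := setPowElm_mul_grpElm T₁ 1
  simp only [zsmul_eq_mul] at heq2 ⊢
  push_cast at heq2 ⊢
  refine ⟨hatT4_mul_eq heq1 ?_ hS hA hB hSG hab,
    hatT4_mul_eq (by rw [mul_comm, heq1]) ?_ hS hB hA ?_ ?_⟩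
  · linear_combination heq2
  · linear_combination heq2
  · linear_combination hSG
  · linear_combination hab
end

section
/- Let n be a positive integer, H a finite abelian group of order n²+n+1, and T₀, T₁ inverse-closed subsets of H with e ∈ T₀ satisfying the APLL group-ring equations, and set k₁ = |T₁|. Then there exists a nonnegative integer η such that Σ_{i≥1} |V_i| = (2n+1)k₁ − 2(k₁−1)k₁ + η + Σ_{s≥3} ((s−1)(s−2)/2)·|V_s|. Moreover, if n is odd, then 2|V₁| + 3|V₂| + 3|V₃| + 2|V₄| ≥ 2n² + 4n + 2. -/
open scoped Classical Pointwise

/-- A weighted sum over the level sets of `c` is the sum of the weights of the values of `c`. -/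
theorem tsum_mul_ncard_fiber {α : Type*} [Fintype α] (c : α → ℕ) (f : ℕ → ℚ) :
    ∑' i : ℕ, f i * ({a : α | c a = i}.ncard : ℚ) = ∑ a, f (c a) := by
  rw [tsum_eq_sum (s := Finset.univ.image c)]
  · rw [← Finset.sum_fiberwise_of_maps_to (s := Finset.univ) (t := Finset.univ.image c) (g := c)
      (fun a _ => Finset.mem_image_of_mem c (Finset.mem_univ a))]
    refine Finset.sum_congr rfl fun i _ => ?_
    rw [Finset.sum_congr rfl (g := fun _ => f i) (fun a ha => by rw [(Finset.mem_filter.1 ha).2]),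
      Finset.sum_const, nsmul_eq_mul, mul_comm, Set.ncard_eq_toFinset_card']
    congr 3
    ext a
    simp
  · intro i hi
    have : {a : α | c a = i} = ∅ := by
      ext a
      simp only [Set.mem_ofPred_eq, Set.mem_empty_iff_false, iff_false]
      exact fun h => hi (Finset.mem_image.2 ⟨a, Finset.mem_univ a, h⟩)
    simp [this]

theorem sum_card_fiber {α β : Type*} [Fintype β] (S : Finset α) (f : α → β) :
    ∑ b, (S.filter fun a => f a = b).card = S.card :=
  (Finset.card_eq_sum_card_fiberwise (fun _ _ => Finset.mem_univ _)).symm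

theorem sum_card_fiber_sq_s10 {α β : Type*} [Fintype β] (S : Finset α) (f : α → β) :
    ∑ b, (S.filter fun a => f a = b).card ^ 2
      = ((S ×ˢ S).filter fun p => f p.1 = f p.2).card := by
  rw [← sum_card_fiber _ (fun p : α × α => f p.1)]
  refine Finset.sum_congr rfl fun b _ => ?_
  rw [sq, ← Finset.card_product]
  congr 1
  ext p
  simp only [Finset.mem_product, Finset.mem_filter]
  grind

theorem ncard_pairs_eq_card_filter {α β : Type*} [Fintype α] (S T : Set α)
    [Fintype S] [Fintype T] (f : α × α → β)
    (b : β) :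
    {p : α × α | p.1 ∈ S ∧ p.2 ∈ T ∧ f p = b}.ncard
      = ((S.toFinset ×ˢ T.toFinset).filter fun p => f p = b).card := by
  rw [Set.ncard_eq_toFinset_card']
  congr 1
  ext p
  simp [and_assoc]

theorem ncard_sep_eq_card_filter {α β : Type*} [Fintype α] (S : Set α) [Fintype S]
    (f : α → β) (b : β) :
    {a : α | a ∈ S ∧ f a = b}.ncard = (S.toFinset.filter fun a => f a = b).card := by
  rw [Set.ncard_eq_toFinset_card']
  congr 1
  ext p
  simp

section
variable {H : Type*} [CommGroup H] [Fintype H] {n : ℕ} {T₀ T₁ : Set H}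

theorem APLLEqs.disjoint (h : APLLEqs n T₀ T₁) (hT₁ : T₁⁻¹ = T₁) : Disjoint T₀ T₁ := by
  rw [Set.disjoint_left]
  intro t h0 h1
  have h2 : t⁻¹ ∈ T₁ := by rw [← hT₁]; simpa using h1
  have h3 := h.1 1
  rw [if_pos rfl, Set.ncard_eq_zero] at h3
  exact (Set.ext_iff.1 h3 (t, t⁻¹)).1 ⟨h0, h2, mul_inv_cancel t⟩

theorem APLLEqs.ncard_mul (h : APLLEqs n T₀ T₁) (hcard : Fintype.card H = n ^ 2 + n + 1) :
    T₀.ncard * T₁.ncard = n ^ 2 + n := by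
  have h1 := sum_card_fiber (T₀.toFinset ×ˢ T₁.toFinset) (fun p : H × H => p.1 * p.2)
  simp_rw [← ncard_pairs_eq_card_filter, h.1] at h1
  rw [Finset.card_product, ← Set.ncard_eq_toFinset_card', ← Set.ncard_eq_toFinset_card'] at h1
  rw [← h1]
  have h2 : ∑ b : H, ((if b = 1 then 0 else 1) + if b = 1 then 1 else 0) = n ^ 2 + n + 1 := by
    rw [← hcard, Finset.sum_congr rfl (g := fun _ => 1) (by intro b _; split_ifs <;> rfl)]
    simp
  rw [Finset.sum_add_distrib] at h2
  simpa using h2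

theorem APLLEqs.ncard_add (h : APLLEqs n T₀ T₁) (hcard : Fintype.card H = n ^ 2 + n + 1) :
    T₀.ncard + T₁.ncard = 2 * n + 1 := by
  have h0 := h.ncard_mul hcard
  have h1 := Finset.sum_congr (rfl : (Finset.univ : Finset H) = _) fun b _ => h.2 b
  simp_rw [Finset.sum_add_distrib] at h1
  simp_rw [ncard_pairs_eq_card_filter _ _ (fun p : H × H => p.1 * p.2),
    ncard_sep_eq_card_filter _ (fun t : H => t ^ 2), sum_card_fiber, Finset.card_product,
    ← Set.ncard_eq_toFinset_card'] at h1
  simp only [Finset.sum_const, Finset.card_univ, hcard, smul_eq_mul, Finset.sum_ite_eq',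
    Finset.mem_univ, if_true] at h1
  nlinarith

theorem pow_four_bijective (hcard : Fintype.card H = n ^ 2 + n + 1) :
    Function.Bijective (fun g : H => g ^ 4) := by
  have hodd : ¬ 2 ∣ n ^ 2 + n + 1 := by
    have := Nat.even_mul_succ_self n
    rw [Nat.two_dvd_ne_zero, ← Nat.odd_iff]
    have h2 : n ^ 2 + n = n * (n + 1) := by ring
    rw [h2]
    exact this.add_one
  refine (powCoprime (G := H) (n := 4) ?_).bijective
  rw [Nat.card_eq_fintype_card, hcard]
  exact (((Nat.Prime.coprime_iff_not_dvd Nat.prime_two).2 hodd).pow_left 2).symm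

/-- The products of two elements of `T₀ ∪ T₁` cover every nonidentity element at most four
times. -/
theorem APLLEqs.card_mul_fiber_le (h : APLLEqs n T₀ T₁) {d : H} (hd : d ≠ 1) :
    (((T₀ ∪ T₁).toFinset ×ˢ (T₀ ∪ T₁).toFinset).filter fun p : H × H => p.1 * p.2 = d).card
      ≤ 4 := by
  have h1 := h.1 d
  have h2 := h.2 d
  rw [if_neg hd] at h1 h2
  have h3 : {p : H × H | p.1 ∈ T₁ ∧ p.2 ∈ T₀ ∧ p.1 * p.2 = d}.ncard = 1 := by
    rw [← h1, ← Set.ncard_image_of_injective _ (Prod.swap_injective (α := H) (β := H))]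
    congr 1
    ext ⟨a, b⟩
    simp [and_left_comm, mul_comm a b]
  rw [← ncard_pairs_eq_card_filter _ _ (fun p : H × H => p.1 * p.2)]
  have hsub : {p : H × H | p.1 ∈ T₀ ∪ T₁ ∧ p.2 ∈ T₀ ∪ T₁ ∧ p.1 * p.2 = d}
      ⊆ ({p : H × H | p.1 ∈ T₀ ∧ p.2 ∈ T₀ ∧ p.1 * p.2 = d}
          ∪ {p : H × H | p.1 ∈ T₁ ∧ p.2 ∈ T₁ ∧ p.1 * p.2 = d})
        ∪ ({p : H × H | p.1 ∈ T₀ ∧ p.2 ∈ T₁ ∧ p.1 * p.2 = d}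
          ∪ {p : H × H | p.1 ∈ T₁ ∧ p.2 ∈ T₀ ∧ p.1 * p.2 = d}) := by
    rintro p ⟨h0 | h0, h1 | h1, h2⟩ <;> simp [*]
  have h4 := Set.ncard_le_ncard hsub (Set.toFinite _)
  have h5 := Set.ncard_union_le ({p : H × H | p.1 ∈ T₀ ∧ p.2 ∈ T₀ ∧ p.1 * p.2 = d}
          ∪ {p : H × H | p.1 ∈ T₁ ∧ p.2 ∈ T₁ ∧ p.1 * p.2 = d})
        ({p : H × H | p.1 ∈ T₀ ∧ p.2 ∈ T₁ ∧ p.1 * p.2 = d}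
          ∪ {p : H × H | p.1 ∈ T₁ ∧ p.2 ∈ T₀ ∧ p.1 * p.2 = d})
  have h6 := Set.ncard_union_le {p : H × H | p.1 ∈ T₀ ∧ p.2 ∈ T₀ ∧ p.1 * p.2 = d}
          {p : H × H | p.1 ∈ T₁ ∧ p.2 ∈ T₁ ∧ p.1 * p.2 = d}
  have h7 := Set.ncard_union_le {p : H × H | p.1 ∈ T₀ ∧ p.2 ∈ T₁ ∧ p.1 * p.2 = d}
          {p : H × H | p.1 ∈ T₁ ∧ p.2 ∈ T₀ ∧ p.1 * p.2 = d}
  omega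

/-- The coefficients of `T̂⁽⁴⁾T₁` have square sum at most `|T̂||T₁| + 4(|T₁|² - |T₁|)`. -/
theorem APLLEqs.sum_sq_le (h : APLLEqs n T₀ T₁) (hcard : Fintype.card H = n ^ 2 + n + 1)
    (hT₀ : T₀⁻¹ = T₀) (hT₁ : T₁⁻¹ = T₁) :
    ∑ x : H, {p : H × H | p.1 ∈ T₀ ∪ T₁ ∧ p.2 ∈ T₁ ∧ p.1 ^ 4 * p.2 = x}.ncard ^ 2
      ≤ (T₀ ∪ T₁).ncard * T₁.ncard + 4 * (T₁.ncard * T₁.ncard - T₁.ncard) := by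
  have hbij := pow_four_bijective (H := H) hcard
  simp_rw [ncard_pairs_eq_card_filter _ _ (fun p : H × H => p.1 ^ 4 * p.2), sum_card_fiber_sq_s10,
    Set.ncard_eq_toFinset_card']
  set U := (T₀ ∪ T₁).toFinset with hU
  set B := T₁.toFinset
  have hUinv : ∀ g ∈ U, g⁻¹ ∈ U := by
    intro g hg
    rw [hU, Set.mem_toFinset] at hg ⊢
    rw [← Set.mem_inv, Set.union_inv, hT₀, hT₁]
    exact hg
  set Q := ((U ×ˢ B) ×ˢ (U ×ˢ B)).filter fun q => q.1.1 ^ 4 * q.1.2 = q.2.1 ^ 4 * q.2.2 with hQ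
  have hmaps : Set.MapsTo (fun q : (H × H) × H × H => (q.1.2, q.2.2)) Q (B ×ˢ B : Finset _) := by
    intro q hq
    simp only [hQ, Finset.mem_coe, Finset.mem_filter, Finset.mem_product] at hq
    exact Finset.mem_product.2 ⟨hq.1.1.2, hq.1.2.2⟩
  rw [Finset.card_eq_sum_card_fiberwise (f := fun q => (q.1.2, q.2.2)) (t := B ×ˢ B) hmaps,
    ← Finset.diag_union_offDiag, Finset.sum_union (Finset.disjoint_diag_offDiag B)]
  refine add_le_add ?_ ?_
  · rw [mul_comm, ← Finset.diag_card B, ← smul_eq_mul]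
    refine Finset.sum_le_card_nsmul _ _ _ fun b hb => ?_
    refine Finset.card_le_card_of_injOn (fun q => q.1.1) ?_ ?_
    · intro q hq
      simp only [hQ, Finset.coe_filter, Finset.mem_filter, Finset.mem_product,
        Set.mem_ofPred_eq] at hq
      exact hq.1.1.1.1
    · rintro ⟨⟨g, t⟩, g', t'⟩ hq ⟨⟨k, s⟩, k', s'⟩ hr hgk
      simp only [hQ, Finset.coe_filter, Finset.mem_filter, Finset.mem_product,
        Set.mem_ofPred_eq] at hq hr hgk
      obtain ⟨⟨-, hq1⟩, rfl⟩ := hq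
      obtain ⟨⟨-, hr1⟩, hr2⟩ := hr
      simp only [Prod.mk.injEq] at hr2
      obtain ⟨rfl, rfl⟩ := hr2
      subst hgk
      have : g' ^ 4 = k' ^ 4 := mul_right_cancel (hq1.symm.trans hr1)
      rw [hbij.1 this]
  · rw [← Finset.offDiag_card, mul_comm, ← smul_eq_mul]
    refine Finset.sum_le_card_nsmul _ _ _ ?_
    rintro ⟨t, t'⟩ hb
    have hne : t ≠ t' := (Finset.mem_offDiag.1 hb).2.2
    obtain ⟨d, hd⟩ := hbij.2 (t' * t⁻¹)
    replace hd : d ^ 4 = t' * t⁻¹ := hd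
    have hd1 : d ≠ 1 := by
      rintro rfl
      rw [one_pow, eq_comm, mul_inv_eq_one] at hd
      exact hne hd.symm
    refine le_trans ?_ (h.card_mul_fiber_le hd1)
    refine Finset.card_le_card_of_injOn (fun q => (q.1.1, q.2.1⁻¹)) ?_ ?_
    · rintro ⟨⟨g, s⟩, g', s'⟩ hq
      simp only [hQ, Finset.coe_filter, Finset.mem_filter, Finset.mem_product,
        Set.mem_ofPred_eq, Prod.mk.injEq] at hq ⊢
      obtain ⟨⟨⟨hg, hg'⟩, he⟩, rfl, rfl⟩ := hq
      refine ⟨⟨hg.1, hUinv _ hg'.1⟩, hbij.1 ?_⟩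
      simp only [hd]
      rw [mul_pow, inv_pow, mul_inv_eq_iff_eq_mul, mul_right_comm, eq_mul_inv_iff_mul_eq, he,
        mul_comm]
    · rintro ⟨⟨g, s⟩, g', s'⟩ hq ⟨⟨k, r⟩, k', r'⟩ hr hgk
      simp only [hQ, Finset.coe_filter, Finset.mem_filter, Set.mem_ofPred_eq,
        Prod.mk.injEq, inv_inj] at hq hr hgk ⊢
      obtain ⟨-, rfl, rfl⟩ := hq
      obtain ⟨-, rfl, rfl⟩ := hr
      exact ⟨⟨hgk.1, rfl⟩, hgk.2, rfl⟩

theorem even_ncard_of_inv_eq (hcard : Fintype.card H = n ^ 2 + n + 1) (hT₁ : T₁⁻¹ = T₁)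
    (h1 : (1 : H) ∉ T₁) : Even T₁.ncard := by
  rw [Set.ncard_eq_toFinset_card', ← ZMod.natCast_eq_zero_iff_even, Finset.cast_card]
  refine Finset.sum_involution (fun t _ => t⁻¹) (fun _ _ => by decide) ?_ ?_ ?_
  · intro t ht _ heq
    have h2 : t ^ 4 = 1 ^ 4 := by
      rw [show 4 = 2 * 2 from rfl, pow_mul, sq t]
      nth_rewrite 1 [← heq]
      simp
    rw [(pow_four_bijective hcard).1 h2] at ht
    exact h1 (Set.mem_toFinset.1 ht)
  · intro t ht
    rw [Set.mem_toFinset] at ht ⊢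
    rw [← Set.mem_inv, hT₁]
    exact ht
  · simp

end

/-- Inclusion–exclusion identity for the coefficient classes `V_i` of `T̂⁽⁴⁾T₁`:
there is a nonnegative integer `η` with
`Σ_{i≥1}|V_i| = (2n+1)k₁ − 2(k₁−1)k₁ + η + Σ_{s≥3} ((s−1)(s−2)/2)|V_s|`;
moreover, for odd `n`, `2|V₁| + 3|V₂| + 3|V₃| + 2|V₄| ≥ 2n² + 4n + 2`. -/
theorem Vi_inclusion_exclusion (n : ℕ) (hn : 0 < n)
    {H : Type*} [CommGroup H] [Fintype H]
    (hcard : Fintype.card H = n ^ 2 + n + 1)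
    (T₀ T₁ : Set H) (hT₀inv : T₀⁻¹ = T₀) (hT₁inv : T₁⁻¹ = T₁)
    (he : (1 : H) ∈ T₀) (hAPLL : APLLEqs n T₀ T₁)
    (k₁ : ℕ) (hk₁ : k₁ = T₁.ncard) :
    (∃ η : ℕ,
      (∑' i : ℕ, if 1 ≤ i then ((Vset T₀ T₁ i).ncard : ℚ) else 0)
        = (2 * (n : ℚ) + 1) * k₁ - 2 * ((k₁ : ℚ) - 1) * k₁ + η
          + ∑' s : ℕ, if 3 ≤ s then
              (((s : ℚ) - 1) * ((s : ℚ) - 2) / 2) * ((Vset T₀ T₁ s).ncard : ℚ)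
            else 0) ∧
    (Odd n →
      2 * (Vset T₀ T₁ 1).ncard + 3 * (Vset T₀ T₁ 2).ncard
          + 3 * (Vset T₀ T₁ 3).ncard + 2 * (Vset T₀ T₁ 4).ncard
        ≥ 2 * n ^ 2 + 4 * n + 2) := by
  set c : H → ℕ := fun x =>
    {p : H × H | p.1 ∈ T₀ ∪ T₁ ∧ p.2 ∈ T₁ ∧ p.1 ^ 4 * p.2 = x}.ncard with hc
  have hV : ∀ i, Vset T₀ T₁ i = {x | c x = i} := fun _ => rfl
  have hdisj := hAPLL.disjoint hT₁inv
  have hadd := hAPLL.ncard_add hcard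
  have hU : (T₀ ∪ T₁).ncard = 2 * n + 1 := by rw [Set.ncard_union_eq hdisj, hadd]
  have hsq := hAPLL.sum_sq_le hcard hT₀inv hT₁inv
  have hsum : ∑ x, c x = (2 * n + 1) * k₁ := by
    simp_rw [hc, ncard_pairs_eq_card_filter _ _ (fun p : H × H => p.1 ^ 4 * p.2), sum_card_fiber]
    rw [Finset.card_product, ← Set.ncard_eq_toFinset_card', ← Set.ncard_eq_toFinset_card', hU, hk₁]
  rw [hU, ← hk₁] at hsq
  have hchoose : ∀ x : ℕ, 2 * x.choose 2 + x = x ^ 2 := by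
    intro x
    rw [Nat.choose_two_right, Nat.mul_div_cancel' (Nat.even_mul_pred_self x).two_dvd]
    rcases x with _ | x
    · rfl
    · rw [Nat.add_sub_cancel]
      ring
  have hpairs : ∑ x, (c x).choose 2 ≤ 2 * (k₁ * k₁ - k₁) := by
    have h1 : ∑ x, (2 * (c x).choose 2 + c x) = ∑ x, c x ^ 2 :=
      Finset.sum_congr rfl fun x _ => hchoose (c x)
    rw [Finset.sum_add_distrib, ← Finset.mul_sum, hsum] at h1
    change ∑ x, c x ^ 2 ≤ _ at hsq
    omega
  have hsumQ : ∑ x, (c x : ℚ) = (2 * n + 1) * k₁ := by exact_mod_cast hsum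
  refine ⟨⟨2 * (k₁ * k₁ - k₁) - ∑ x, (c x).choose 2, ?_⟩, fun hodd => ?_⟩
  · have e1 : ∀ i : ℕ, (if 1 ≤ i then ((Vset T₀ T₁ i).ncard : ℚ) else 0)
        = (if 1 ≤ i then 1 else 0) * ({x | c x = i}.ncard : ℚ) := by
      intro i; rw [hV]; split_ifs <;> simp
    have e2 : ∀ s : ℕ, (if 3 ≤ s then
        (((s : ℚ) - 1) * ((s : ℚ) - 2) / 2) * ((Vset T₀ T₁ s).ncard : ℚ) else 0)
        = (if 3 ≤ s then ((s : ℚ) - 1) * ((s : ℚ) - 2) / 2 else 0)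
          * ({x | c x = s}.ncard : ℚ) := by
      intro i; rw [hV]; split_ifs <;> simp
    simp_rw [e1, e2]
    rw [tsum_mul_ncard_fiber c (fun i => if 1 ≤ i then 1 else 0),
      tsum_mul_ncard_fiber c (fun s => if 3 ≤ s then ((s : ℚ) - 1) * ((s : ℚ) - 2) / 2 else 0)]
    have hpt : ∀ x : H, (if 1 ≤ c x then (1 : ℚ) else 0) = (c x : ℚ) - ((c x).choose 2 : ℕ)
        + (if 3 ≤ c x then ((c x : ℚ) - 1) * ((c x : ℚ) - 2) / 2 else 0) := by
      intro x
      have h2 : 2 * ((c x).choose 2 : ℚ) + c x = (c x : ℚ) ^ 2 := by exact_mod_cast hchoose (c x)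
      generalize ((c x).choose 2 : ℚ) = w at h2
      rcases Nat.lt_or_ge (c x) 3 with h3 | h3
      · rw [if_neg (by omega : ¬ 3 ≤ c x)]
        interval_cases c x <;> norm_num at h2 ⊢ <;> linarith
      · rw [if_pos h3, if_pos (by omega)]
        linarith
    rw [Finset.sum_congr rfl fun x _ => hpt x, Finset.sum_add_distrib, Finset.sum_sub_distrib,
      hsumQ, Nat.cast_sub hpairs]
    have hkkQ : ((k₁ * k₁ - k₁ : ℕ) : ℚ) = k₁ * k₁ - k₁ := by
      rw [Nat.cast_sub (Nat.le_mul_self k₁), Nat.cast_mul]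
    rw [Nat.cast_mul, hkkQ]
    push_cast
    ring
  · have h1 : (1 : H) ∉ T₁ := Set.disjoint_left.1 hdisj he
    have heven := even_ncard_of_inv_eq hcard hT₁inv h1
    have hmul := hAPLL.ncard_mul hcard
    have hk : k₁ = n + 1 := by
      rw [← hk₁] at hmul hadd heven
      have h0 : ((k₁ : ℤ) - n) * (k₁ - (n + 1)) = 0 := by zify at hmul hadd; nlinarith
      rcases mul_eq_zero.1 h0 with h | h
      · obtain rfl : k₁ = n := by omega
        exact absurd heven (Nat.not_even_iff_odd.2 hodd)
      · omega
    have hcount : ∀ i, (Vset T₀ T₁ i).ncard = ∑ x, if c x = i then 1 else 0 := by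
      intro i
      rw [hV, Set.ncard_eq_toFinset_card', Finset.sum_boole, Nat.cast_id]
      congr 1
      ext x
      simp
    simp_rw [hcount, Finset.mul_sum, ← Finset.sum_add_distrib]
    have hpt : ∀ x, 2 * c x ≤ 2 * (if c x = 1 then 1 else 0) + 3 * (if c x = 2 then 1 else 0)
        + 3 * (if c x = 3 then 1 else 0) + 2 * (if c x = 4 then 1 else 0)
        + (c x).choose 2 := by
      intro x
      have h2 := hchoose (c x)
      rcases Nat.lt_or_ge (c x) 5 with h5 | h5
      · interval_cases c x <;> decide
      · have h6 : 5 * c x ≤ c x ^ 2 := by nlinarith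
        omega
    have hle := Finset.sum_le_sum fun x (_ : x ∈ Finset.univ) => hpt x
    rw [← Finset.mul_sum, hsum, Finset.sum_add_distrib] at hle
    have hkk := Nat.sub_add_cancel (Nat.le_mul_self k₁)
    subst hk
    nlinarith
end

section
/- Let n be a positive odd integer with n ≥ 19, n ≡ 0 (mod 5) and n ≡ 2 (mod 3). Then for every finite abelian group H of order n²+n+1 there exist no inverse-closed subsets T₀, T₁ of H with e ∈ T₀ satisfying the APLL group-ring equations. -/
open scoped Classical Pointwise

section PowerSums

open MonoidAlgebra Finset

variable (R : Type*) [CommRing R] {H : Type*} [CommGroup H]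

/-- The image of a finite subset `S` of `H` in the group ring `R[H]`, after raising all its
elements to the `k`-th power. -/
noncomputable def powerSum (k : ℕ) (S : Finset H) : MonoidAlgebra R H :=
  ∑ g ∈ S, single (g ^ k) 1

theorem coeff_powerSum (k : ℕ) (S : Finset H) (h : H) :
    (powerSum R k S).coeff h = #{g ∈ S | g ^ k = h} := by
  simp [powerSum, Finsupp.single_apply]

theorem powerSum_one_apply (S : Finset H) (h : H) :
    (powerSum R 1 S).coeff h = if h ∈ S then 1 else 0 := by
  simp [powerSum, Finsupp.single_apply]

theorem coeff_powerSum_mul (k l : ℕ) (S T : Finset H) (h : H) :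
    (powerSum R k S * powerSum R l T).coeff h
      = #{p ∈ S ×ˢ T | p.1 ^ k * p.2 ^ l = h} := by
  simp only [powerSum, Finset.sum_mul_sum, ← Finset.sum_product']
  simp [Finsupp.single_apply]

theorem mapDomainRingHom_powerSum (k l : ℕ) (S : Finset H) :
    mapDomainRingHom R (powMonoidHom l : H →* H) (powerSum R k S) = powerSum R (k * l) S := by
  simp [powerSum, pow_mul]

theorem powerSum_one_pow_char (p : ℕ) [Fact p.Prime] [CharP R p] (S : Finset H) :
    powerSum R 1 S ^ p = powerSum R p S := by
  have : CharP (MonoidAlgebra R H) p :=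
    charP_of_injective_algebraMap (FaithfulSMul.algebraMap_injective R _) p
  simp [powerSum, sum_pow_char]

variable [Fintype H]

theorem powerSum_mul_univ (k : ℕ) (S : Finset H) :
    powerSum R k S * powerSum R 1 univ = (#S : MonoidAlgebra R H) * powerSum R 1 univ := by
  rw [powerSum, Finset.sum_mul, Finset.sum_congr rfl (g := fun _ => powerSum R 1 univ)]
  · simp
  · intro g _
    simp only [powerSum, pow_one, Finset.mul_sum, single_mul_single, mul_one]
    exact Fintype.sum_equiv (Equiv.mulLeft (g ^ k)) _ _ fun _ => rfl

theorem powerSum_univ_of_coprime {k : ℕ} (hk : (Nat.card H).Coprime k) :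
    powerSum R k (univ : Finset H) = powerSum R 1 univ := by
  simp only [powerSum, pow_one]
  exact Fintype.sum_equiv (powCoprime hk) _ _ fun _ => rfl

theorem sum_card_fiber_s11 (k : ℕ) (S T : Finset H) :
    ∑ h : H, #{p ∈ S ×ˢ T | p.1 ^ k * p.2 ^ 1 = h} = #S * #T := by
  rw [← card_product]
  exact (card_eq_sum_card_fiberwise fun _ _ => mem_coe.2 (mem_univ _)).symm

end PowerSums

section GroupRingEquations

open MonoidAlgebra Finset

theorem APLLEqs.symm {H : Type*} [CommGroup H] {n : ℕ} {S T : Set H}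
    (h : APLLEqs n S T) : APLLEqs n T S := by
  refine ⟨fun g => ?_, fun g => ?_⟩
  · rw [← h.1 g, ← Set.ncard_image_of_injective _ Prod.swap_injective]
    congr 1
    ext ⟨a, b⟩
    simp [mul_comm a b, and_left_comm]
  · rw [← h.2 g]
    ring

variable (R : Type*) [CommRing R] {H : Type*} [CommGroup H] [Fintype H] {n : ℕ} {S T : Finset H}

theorem APLLEqs.powerSum_mul (h : APLLEqs n (S : Set H) T) :
    powerSum R 1 S * powerSum R 1 T = powerSum R 1 univ - 1 := by
  ext g
  have hg := h.1 g
  have hc : {p : H × H | p.1 ∈ (S : Set H) ∧ p.2 ∈ (T : Set H) ∧ p.1 * p.2 = g}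
      = ({p ∈ S ×ˢ T | p.1 ^ 1 * p.2 ^ 1 = g} : Finset (H × H)) := by
    ext; simp [and_assoc]
  rw [hc, Set.ncard_coe_finset] at hg
  rw [coeff_powerSum_mul, hg, coeff_sub, Finsupp.sub_apply, powerSum_one_apply]
  by_cases h1 : g = 1 <;> simp [h1, one_def]

theorem APLLEqs.powerSum_sq_add (h : APLLEqs n (S : Set H) T) :
    powerSum R 1 S ^ 2 + powerSum R 1 T ^ 2 + (powerSum R 2 S + powerSum R 2 T)
      = 2 * powerSum R 1 univ + 2 * (n : MonoidAlgebra R H) := by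
  ext g
  have hg := h.2 g
  have hc (U : Finset H) : {p : H × H | p.1 ∈ (U : Set H) ∧ p.2 ∈ (U : Set H) ∧ p.1 * p.2 = g}
      = ({p ∈ U ×ˢ U | p.1 ^ 1 * p.2 ^ 1 = g} : Finset (H × H)) := by
    ext; simp [and_assoc]
  have hs (U : Finset H) : {t : H | t ∈ (U : Set H) ∧ t ^ 2 = g}
      = ({t ∈ U | t ^ 2 = g} : Finset H) := by
    ext; simp
  rw [hc, hc, hs, hs] at hg
  simp only [Set.ncard_coe_finset] at hg
  have hR := congrArg (Nat.cast (R := R)) hg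
  push_cast at hR
  simp only [pow_two (powerSum R 1 _), coeff_add, Finsupp.add_apply, coeff_powerSum_mul,
    two_mul, powerSum_one_apply, coeff_natCast, Finsupp.single_apply,
    mem_univ, if_true, eq_comm (a := (1 : H))]
  simp only [coeff_powerSum]
  rw [← add_assoc, hR]
  split_ifs <;> ring

theorem APLLEqs.card_mul_card (h : APLLEqs n (S : Set H) T) :
    (#S : ℤ) * #T = Fintype.card H - 1 := by
  have := congrArg (lift ℤ ℤ H (1 : H →* ℤ)) (h.powerSum_mul ℤ)
  simpa [powerSum] using this

theorem APLLEqs.card_sq_add (h : APLLEqs n (S : Set H) T) :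
    (#S : ℤ) ^ 2 + #T ^ 2 + (#S + #T) = 2 * Fintype.card H + 2 * n := by
  have := congrArg (lift ℤ ℤ H (1 : H →* ℤ)) (h.powerSum_sq_add ℤ)
  simp only [map_add, map_mul, map_pow, map_ofNat, map_natCast] at this
  simpa [powerSum] using this

theorem APLLEqs.card_eq (h : APLLEqs n (S : Set H) T) (hH : Fintype.card H = n ^ 2 + n + 1) :
    #S = n ∧ #T = n + 1 ∨ #S = n + 1 ∧ #T = n := by
  have h1 := h.card_mul_card
  have h2 := h.card_sq_add
  rw [hH] at h1 h2
  push_cast at h1 h2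
  have h3 : ((#S : ℤ) + #T - (2 * n + 1)) * ((#S : ℤ) + #T + (2 * n + 2)) = 0 := by
    linear_combination h2 + 2 * h1
  have h4 : (#S : ℤ) + #T = 2 * n + 1 := by
    rcases mul_eq_zero.1 h3 with h | h <;> lia
  have h5 : ((#S : ℤ) - n) * (#S - (n + 1)) = 0 := by
    linear_combination (#S : ℤ) * h4 - h1
  rcases mul_eq_zero.1 h5 with h | h <;> lia

variable (H) in
theorem powerSum_univ_two (hH : Odd (Fintype.card H)) :
    mapDomainRingHom R (powMonoidHom 2 : H →* H) (powerSum R 1 univ) = powerSum R 1 univ := by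
  rw [mapDomainRingHom_powerSum, one_mul, powerSum_univ_of_coprime]
  rwa [Nat.card_eq_fintype_card, Nat.coprime_two_right]

/-- The group-ring equation for `T̂⁽²⁾ T₀` in characteristic 3. -/
theorem APLLEqs.powerSum_two_mul_of_three (h : APLLEqs n (S : Set H) T) (hS : #S = n)
    (hT : #T = n + 1) (h3 : n % 3 = 2) :
    (powerSum (ZMod 3) 2 S + powerSum (ZMod 3) 2 T) * powerSum (ZMod 3) 1 S
      = powerSum (ZMod 3) 1 univ + powerSum (ZMod 3) 1 S + powerSum (ZMod 3) 1 T
        - powerSum (ZMod 3) 3 S := by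
  have : CharP (MonoidAlgebra (ZMod 3) H) 3 :=
    charP_of_injective_algebraMap (FaithfulSMul.algebraMap_injective (ZMod 3) _) 3
  have hn : (n : MonoidAlgebra (ZMod 3) H) = 2 := by
    exact_mod_cast (CharP.cast_eq_iff_mod_eq (MonoidAlgebra (ZMod 3) H) 3 (a := n) (b := 2)).2 h3
  have h30 : (3 : MonoidAlgebra (ZMod 3) H) = 0 := by
    exact_mod_cast CharP.cast_eq_zero (MonoidAlgebra (ZMod 3) H) 3
  have h1 := h.powerSum_mul (ZMod 3)
  have h2 := h.powerSum_sq_add (ZMod 3)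
  have hJS := powerSum_mul_univ (ZMod 3) 1 S
  have hJT := powerSum_mul_univ (ZMod 3) 1 T
  rw [← powerSum_one_pow_char _ 3]
  rw [hS, hn] at hJS
  rw [hT, Nat.cast_add, hn] at hJT
  rw [hn] at h2
  push_cast at hJT
  generalize powerSum (ZMod 3) 1 S = A at *
  generalize powerSum (ZMod 3) 1 T = B at *
  generalize powerSum (ZMod 3) 1 (univ : Finset H) = J at *
  linear_combination A * h2 - B * h1 + 2 * hJS - hJT + A * h30

/-- The group-ring equation for `T̂⁽⁴⁾ T₁ + T̂⁽²⁾ T₀` in characteristic 5. -/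
theorem APLLEqs.powerSum_four_mul_of_five (h : APLLEqs n (S : Set H) T) (hS : #S = n)
    (hT : #T = n + 1) (h5 : n % 5 = 0) (hH : Odd (Fintype.card H)) :
    (powerSum (ZMod 5) 4 S + powerSum (ZMod 5) 4 T) * powerSum (ZMod 5) 1 T
        + (powerSum (ZMod 5) 2 S + powerSum (ZMod 5) 2 T) * powerSum (ZMod 5) 1 S
      = 2 * powerSum (ZMod 5) 1 T - powerSum (ZMod 5) 5 T := by
  have : CharP (MonoidAlgebra (ZMod 5) H) 5 :=
    charP_of_injective_algebraMap (FaithfulSMul.algebraMap_injective (ZMod 5) _) 5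
  have hn : (n : MonoidAlgebra (ZMod 5) H) = 0 :=
    (CharP.cast_eq_zero_iff _ 5 n).2 (Nat.dvd_of_mod_eq_zero h5)
  have h50 : (5 : MonoidAlgebra (ZMod 5) H) = 0 := by
    exact_mod_cast CharP.cast_eq_zero (MonoidAlgebra (ZMod 5) H) 5
  have h1 := h.powerSum_mul (ZMod 5)
  have h2 := h.powerSum_sq_add (ZMod 5)
  have h1' := congrArg (mapDomainRingHom (ZMod 5) (powMonoidHom 2 : H →* H)) h1
  have h2' := congrArg (mapDomainRingHom (ZMod 5) (powMonoidHom 2 : H →* H)) h2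
  simp only [map_add, map_sub, map_mul, map_pow, map_one, map_ofNat, map_natCast,
    powerSum_univ_two _ _ hH] at h1' h2'
  simp only [mapDomainRingHom_powerSum, one_mul, Nat.reduceMul] at h1' h2'
  have hJS := powerSum_mul_univ (ZMod 5) 1 S
  have hJT := powerSum_mul_univ (ZMod 5) 1 T
  have hJS2 := powerSum_mul_univ (ZMod 5) 2 S
  have hJT2 := powerSum_mul_univ (ZMod 5) 2 T
  have : Fact (Nat.Prime 5) := ⟨Nat.prime_five⟩
  rw [← powerSum_one_pow_char _ 5]
  rw [hS, hn] at hJS hJS2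
  rw [hT, Nat.cast_add, hn] at hJT hJT2
  rw [hn] at h2 h2'
  push_cast at hJT hJT2
  generalize powerSum (ZMod 5) 1 S = A at *
  generalize powerSum (ZMod 5) 1 T = B at *
  generalize powerSum (ZMod 5) 2 S = A₂ at *
  generalize powerSum (ZMod 5) 2 T = B₂ at *
  generalize powerSum (ZMod 5) 4 S = A₄ at *
  generalize powerSum (ZMod 5) 4 T = B₄ at *
  generalize powerSum (ZMod 5) 1 (univ : Finset H) = J at *
  have hB : (A₂ + B₂) * B = 2 * J + A - B ^ 3 := by
    linear_combination B * h2 - A * h1 + 2 * hJT - hJS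
  have hsq : (A₂ + B₂) ^ 2 = 4 * J - 2 - (A₄ + B₄) := by
    linear_combination h2' + 2 * h1'
  linear_combination (B * hsq - (A₂ + B₂) * hB + B ^ 2 * hB + B * h1 + (2 * B + 7) * hJT
    - 2 * (hJS2 + hJT2) + (J - B) * h50)

/-- Away from a small exceptional set, `T̂⁽⁴⁾ T₁ + T̂⁽²⁾ T₀` has coefficients at least 5. -/
theorem APLLEqs.five_le_coeff (h : APLLEqs n (S : Set H) T) (hS : #S = n) (hT : #T = n + 1)
    (h3 : n % 3 = 2) (h5 : n % 5 = 0) (hH : Odd (Fintype.card H)) {g : H}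
    (hgS : g ∉ S) (hgT : g ∉ T) (hgS3 : g ∉ S.image (· ^ 3)) (hgT5 : g ∉ T.image (· ^ 5)) :
    5 ≤ #{p ∈ S ×ˢ T | p.1 ^ 4 * p.2 ^ 1 = g} + #{p ∈ T ×ˢ T | p.1 ^ 4 * p.2 ^ 1 = g}
      + (#{p ∈ S ×ˢ S | p.1 ^ 2 * p.2 ^ 1 = g} + #{p ∈ T ×ˢ S | p.1 ^ 2 * p.2 ^ 1 = g}) := by
  have hz {k : ℕ} {U : Finset H} (hg : g ∉ U.image (· ^ k)) : #{t ∈ U | t ^ k = g} = 0 := by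
    rw [card_eq_zero, filter_eq_empty_iff]
    exact fun t ht e => hg (mem_image.2 ⟨t, ht, e⟩)
  have e3 := congrArg (fun z => z.coeff g) (h.powerSum_two_mul_of_three hS hT h3)
  have e5 := congrArg (fun z => z.coeff g) (h.powerSum_four_mul_of_five hS hT h5 hH)
  simp only [add_mul, two_mul, coeff_add, coeff_sub, Finsupp.add_apply, Finsupp.sub_apply,
    coeff_powerSum_mul, powerSum_one_apply, hgS, hgT, mem_univ, if_true, if_false, add_zero] at e3 e5
  simp only [coeff_powerSum, hz hgS3, hz hgT5, Nat.cast_zero, sub_zero] at e3 e5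
  norm_cast at e3 e5
  replace e3 := (ZMod.natCast_eq_natCast_iff' _ 1 3).1 (by simpa only [Nat.cast_one] using e3)
  rw [ZMod.natCast_eq_zero_iff] at e5
  lia

theorem APLLEqs.sq_le (h : APLLEqs n (S : Set H) T) (hS : #S = n) (hT : #T = n + 1)
    (h3 : n % 3 = 2) (h5 : n % 5 = 0) (hH : Fintype.card H = n ^ 2 + n + 1) :
    n ^ 2 ≤ 19 * n + 6 := by
  have hodd : Odd (Fintype.card H) := by
    rw [hH, pow_two, ← Nat.mul_succ]
    exact (Nat.even_mul_succ_self n).add_one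
  set E : Finset H := S ∪ T ∪ (S.image (· ^ 3) ∪ T.image (· ^ 5)) with hE
  have hEcard : #E ≤ 4 * n + 2 := by
    have h1 := card_union_le (S ∪ T) (S.image (· ^ 3) ∪ T.image (· ^ 5))
    have h2 := card_union_le S T
    have h3 := card_union_le (S.image (· ^ 3)) (T.image (· ^ 5))
    have h4 : #(S.image (· ^ 3)) ≤ #S := card_image_le
    have h5 : #(T.image (· ^ 5)) ≤ #T := card_image_le
    lia
  have hsum := sum_le_sum_of_subset (f := fun g =>
    #{p ∈ S ×ˢ T | p.1 ^ 4 * p.2 ^ 1 = g} + #{p ∈ T ×ˢ T | p.1 ^ 4 * p.2 ^ 1 = g}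
      + (#{p ∈ S ×ˢ S | p.1 ^ 2 * p.2 ^ 1 = g} + #{p ∈ T ×ˢ S | p.1 ^ 2 * p.2 ^ 1 = g}))
    (subset_univ Eᶜ)
  have hlow := card_nsmul_le_sum Eᶜ _ 5 fun g hg => by
    simp only [hE, mem_compl, mem_union, not_or] at hg
    exact h.five_le_coeff hS hT h3 h5 hodd hg.1.1 hg.1.2 hg.2.1 hg.2.2
  have htot := hlow.trans hsum
  simp only [sum_add_distrib, sum_card_fiber_s11, hS, hT, smul_eq_mul, card_compl, hH] at htot
  have : 5 * (n ^ 2 + n + 1) ≤ 5 * (4 * n + 2) + (2 * n + 1) ^ 2 := by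
    have : (n ^ 2 + n + 1 - #E) + #E ≥ n ^ 2 + n + 1 := by lia
    nlinarith
  nlinarith

end GroupRingEquations

/-- Nonexistence of inverse-closed subsets `T₀, T₁` with `e ∈ T₀` satisfying the
APLL group-ring equations, in any finite abelian group of order `n²+n+1`. -/
theorem no_APLL_subsets_odd_ge19_0mod5_2mod3 (n : ℕ) (hn : 0 < n)
    (hodd : Odd n) (hge : 19 ≤ n) (h5 : n % 5 = 0) (h3 : n % 3 = 2)
    (H : Type*) [CommGroup H] [Fintype H]
    (hcard : Fintype.card H = n ^ 2 + n + 1) :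
    ¬ ∃ T₀ T₁ : Set H,
        T₀⁻¹ = T₀ ∧ T₁⁻¹ = T₁ ∧ (1 : H) ∈ T₀ ∧ APLLEqs n T₀ T₁ := by
  rintro ⟨T₀, T₁, -, -, -, h⟩
  rw [← Set.coe_toFinset T₀, ← Set.coe_toFinset T₁] at h
  have hle : n ^ 2 ≤ 19 * n + 6 := by
    rcases h.card_eq hcard with ⟨hS, hT⟩ | ⟨hS, hT⟩
    · exact h.sq_le hS hT h3 h5 hcard
    · exact h.symm.sq_le hT hS h3 h5 hcard
  have : 20 ≤ n := by lia
  nlinarith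
end
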